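/- arXiv:2512.00423 — 8 statements merged into one kernel-verified Lean document; each statement's English description precedes it below -/
import Mathlib

section
/- Let ω be a measurable space with measure μ and let X = L^∞(ω,μ). Let Y be a normed real vector space, let 𝒦₁ : Y → X be a bounded linear operator, let K₂ : X × X → Y be a continuous bilinear map, and let φ ∈ Y with h := ‖𝒦₁φ‖ > 0. Assume there exists b ∈ (1,∞) such that the composed bilinear map (x,x') ↦ 𝒦₁(K₂(x,x')) has operator norm at most (1 − 1/b)/h. Define the fast iterative scheme: η̃⁽⁰⁾ = 0, η̃⁽¹⁾ = 𝒦₁φ, and for n ≥ 1, η̃⁽ⁿ⁺¹⁾ = η̃⁽ⁿ⁾ − 𝒦₁(K₂(η̃⁽ⁿ⁾ − η̃⁽ⁿ⁻¹⁾, η̃⁽¹⁾)). Then the sequence (η̃⁽ⁿ⁾) converges to a unique limit η̃* ∈ X, and for every n ≥ 0 one has ‖η̃⁽ⁿ⁾ − η̃*‖ ≤ b·‖η̃⁽ⁿ⁺¹⁾ − η̃⁽ⁿ⁾‖. -/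
open MeasureTheory Filter

/-- If consecutive steps of a sequence in a complete metric space contract by a factor `r < 1`, the
sequence converges and each term is within `(1 - r)⁻¹` times the next step of the limit. -/
theorem exists_tendsto_of_dist_succ_le_mul {α : Type*} [PseudoMetricSpace α] [CompleteSpace α]
    {f : ℕ → α} {r : ℝ} (hr0 : 0 ≤ r) (hr1 : r < 1)
    (hf : ∀ n, dist (f (n + 1)) (f (n + 2)) ≤ r * dist (f n) (f (n + 1))) :
    ∃ a, Tendsto f atTop (nhds a) ∧ ∀ n, dist (f n) a ≤ dist (f n) (f (n + 1)) / (1 - r) := by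
  have geom (n m : ℕ) :
      dist (f (n + m)) (f (n + (m + 1))) ≤ dist (f n) (f (n + 1)) * r ^ m := by
    induction m with
    | zero => simp
    | succ m ih =>
      calc dist (f (n + (m + 1))) (f (n + (m + 1 + 1)))
          ≤ r * dist (f (n + m)) (f (n + (m + 1))) := hf (n + m)
        _ ≤ r * (dist (f n) (f (n + 1)) * r ^ m) := mul_le_mul_of_nonneg_left ih hr0
        _ = dist (f n) (f (n + 1)) * r ^ (m + 1) := by ring
  have cauchy : CauchySeq f :=
    cauchySeq_of_le_geometric r (dist (f 0) (f 1)) hr1 fun m => by simpa using geom 0 m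
  obtain ⟨a, ha⟩ := cauchySeq_tendsto_of_complete cauchy
  refine ⟨a, ha, fun n => ?_⟩
  have hshift : Tendsto (fun m => f (n + m)) atTop (nhds a) := by
    simpa only [add_comm] using (tendsto_add_atTop_iff_nat n).2 ha
  exact dist_le_of_le_geometric_of_tendsto₀ r _ hr1 (geom n) hshift

/-- **Theorem 3.2 (convergence of the fast iterative scheme).**  Let
`X = L^∞(ω, μ)`, let `𝒦₁ : Y → X` be a bounded linear operator (the regularized
pseudoinverse of the linearized forward operator `K₁`), `K₂ : X × X → Y` the
second-order (bilinear) forward operator, and `φ ∈ Y` the data with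
`h = ‖𝒦₁φ‖ > 0`.  If the composed bilinear map `(x, x') ↦ 𝒦₁(K₂(x, x'))` has
norm at most `(1 - 1/b)/h` for some `b ∈ (1, ∞)`, then the fast iteration
`η̃⁽⁰⁾ = 0`, `η̃⁽¹⁾ = 𝒦₁φ`, `η̃⁽ⁿ⁺¹⁾ = η̃⁽ⁿ⁾ - 𝒦₁K₂((η̃⁽ⁿ⁾ - η̃⁽ⁿ⁻¹⁾) ⊗ η̃⁽¹⁾)`
converges to a unique limit `η̃*` and `‖η̃⁽ⁿ⁾ - η̃*‖ ≤ b ‖η̃⁽ⁿ⁺¹⁾ - η̃⁽ⁿ⁾‖`. -/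
theorem stmt_1
    {ω : Type*} [MeasurableSpace ω] (μ : Measure ω)
    {Y : Type*} [NormedAddCommGroup Y] [NormedSpace ℝ Y]
    (𝒦₁ : Y →L[ℝ] Lp ℝ ⊤ μ) (K₂ : Lp ℝ ⊤ μ →L[ℝ] Lp ℝ ⊤ μ →L[ℝ] Y)
    (φ : Y) (hφ : 0 < ‖𝒦₁ φ‖)
    (b : ℝ) (hb : 1 < b)
    (hnorm : ∀ x x' : Lp ℝ ⊤ μ,
      ‖𝒦₁ (K₂ x x')‖ ≤ (1 - 1 / b) / ‖𝒦₁ φ‖ * (‖x‖ * ‖x'‖))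
    (η : ℕ → Lp ℝ ⊤ μ) (hη0 : η 0 = 0) (hη1 : η 1 = 𝒦₁ φ)
    (hηrec : ∀ n : ℕ, 1 ≤ n → η (n + 1) = η n - 𝒦₁ (K₂ (η n - η (n - 1)) (η 1))) :
    ∃ ηstar : Lp ℝ ⊤ μ,
      Tendsto η atTop (nhds ηstar) ∧
      (∀ y : Lp ℝ ⊤ μ, Tendsto η atTop (nhds y) → y = ηstar) ∧
      ∀ n : ℕ, ‖η n - ηstar‖ ≤ b * ‖η (n + 1) - η n‖ := by
  have hb0 : 0 < b := one_pos.trans hb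
  have hr0 : 0 ≤ 1 - 1 / b := sub_nonneg.2 ((div_le_one hb0).2 hb.le)
  have hr1 : 1 - 1 / b < 1 := sub_lt_self _ (one_div_pos.2 hb0)
  have contract (n : ℕ) :
      dist (η (n + 1)) (η (n + 2)) ≤ (1 - 1 / b) * dist (η n) (η (n + 1)) := by
    have hrec := hηrec (n + 1) n.succ_pos
    rw [Nat.add_sub_cancel] at hrec
    calc dist (η (n + 1)) (η (n + 2))
        = ‖𝒦₁ (K₂ (η (n + 1) - η n) (η 1))‖ := by rw [hrec, dist_eq_norm, sub_sub_cancel]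
      _ ≤ (1 - 1 / b) / ‖𝒦₁ φ‖ * (‖η (n + 1) - η n‖ * ‖η 1‖) := hnorm _ _
      _ = (1 - 1 / b) * dist (η n) (η (n + 1)) := by
        rw [hη1, dist_comm, dist_eq_norm]
        field_simp
  obtain ⟨a, ha, hbound⟩ := exists_tendsto_of_dist_succ_le_mul hr0 hr1 contract
  refine ⟨a, ha, fun y hy => tendsto_nhds_unique hy ha, fun n => ?_⟩
  have hn := hbound n
  rwa [sub_sub_cancel, div_div_eq_mul_div, div_one, mul_comm, dist_eq_norm,
    dist_comm, dist_eq_norm] at hn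
end

section
/- Let X be a Banach space, Y a normed real vector space, 𝒦₁ : Y → X a bounded linear operator, K₂ : X × X → Y a continuous bilinear map, φ ∈ Y with h := ‖𝒦₁φ‖ > 0, and b ∈ (1,∞) such that the composed bilinear map (x,x') ↦ 𝒦₁(K₂(x,x')) has operator norm at most (1 − 1/b)/h. Define η̃⁽⁰⁾ = 0, η̃⁽¹⁾ = 𝒦₁φ, and η̃⁽ⁿ⁺¹⁾ = η̃⁽ⁿ⁾ − 𝒦₁(K₂(η̃⁽ⁿ⁾ − η̃⁽ⁿ⁻¹⁾, η̃⁽¹⁾)) for n ≥ 1. Then the increments decay geometrically: for every n ≥ 0, ‖η̃⁽ⁿ⁺¹⁾ − η̃⁽ⁿ⁾‖ ≤ (1 − 1/b)ⁿ · h. In particular the partial sums η̃⁽ⁿ⁾ = Σ_{j=1}^n (η̃⁽ʲ⁾ − η̃⁽ʲ⁻¹⁾) form a Cauchy sequence in X. -/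
/-- **Geometric decay of the increments of the fast iterative scheme.**  Let `X` be a
Banach space, `Y` a normed space, `𝒦₁ : Y → X` a bounded linear operator,
`K₂ : X × X → Y` a continuous bilinear map, and `φ ∈ Y` with `h = ‖𝒦₁φ‖ > 0`.  If the
composed bilinear map `(x, x') ↦ 𝒦₁(K₂(x, x'))` has norm at most `(1 - 1/b)/h` for some
`b ∈ (1, ∞)`, then the increments of the fast iteration `η̃⁽⁰⁾ = 0`, `η̃⁽¹⁾ = 𝒦₁φ`,
`η̃⁽ⁿ⁺¹⁾ = η̃⁽ⁿ⁾ - 𝒦₁K₂((η̃⁽ⁿ⁾ - η̃⁽ⁿ⁻¹⁾) ⊗ η̃⁽¹⁾)` satisfy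
`‖η̃⁽ⁿ⁺¹⁾ - η̃⁽ⁿ⁾‖ ≤ (1 - 1/b)ⁿ · h`, and in particular the sequence `(η̃⁽ⁿ⁾)` of
partial sums of the increments is a Cauchy sequence in `X`. -/
theorem stmt_2
    {X : Type*} [NormedAddCommGroup X] [NormedSpace ℝ X] [CompleteSpace X]
    {Y : Type*} [NormedAddCommGroup Y] [NormedSpace ℝ Y]
    (𝒦₁ : Y →L[ℝ] X) (K₂ : X →L[ℝ] X →L[ℝ] Y)
    (φ : Y) (hφ : 0 < ‖𝒦₁ φ‖)
    (b : ℝ) (hb : 1 < b)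
    (hnorm : ∀ x x' : X,
      ‖𝒦₁ (K₂ x x')‖ ≤ (1 - 1 / b) / ‖𝒦₁ φ‖ * (‖x‖ * ‖x'‖))
    (η : ℕ → X) (hη0 : η 0 = 0) (hη1 : η 1 = 𝒦₁ φ)
    (hηrec : ∀ n : ℕ, 1 ≤ n → η (n + 1) = η n - 𝒦₁ (K₂ (η n - η (n - 1)) (η 1))) :
    (∀ n : ℕ, ‖η (n + 1) - η n‖ ≤ (1 - 1 / b) ^ n * ‖𝒦₁ φ‖) ∧
    CauchySeq η := by
  have hb0 : (0 : ℝ) < b := by linarith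
  have hr1 : 1 - 1 / b < 1 := by linarith [one_div_pos.mpr hb0]
  have hr0 : 0 ≤ 1 - 1 / b := by
    have : 1 / b ≤ 1 := (div_le_one hb0).mpr hb.le
    linarith
  have hdecay : ∀ n : ℕ, ‖η (n + 1) - η n‖ ≤ (1 - 1 / b) ^ n * ‖𝒦₁ φ‖ := by
    intro n
    induction n with
    | zero => simp [hη0, hη1]
    | succ n ih =>
      have hstep : η (n + 1 + 1) - η (n + 1) = -𝒦₁ (K₂ (η (n + 1) - η n) (𝒦₁ φ)) := by
        rw [hηrec (n + 1) (by omega), Nat.add_sub_cancel, hη1]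
        abel
      calc ‖η (n + 1 + 1) - η (n + 1)‖
          ≤ (1 - 1 / b) / ‖𝒦₁ φ‖ * (‖η (n + 1) - η n‖ * ‖𝒦₁ φ‖) := by
            rw [hstep, norm_neg]
            exact hnorm _ _
        _ = (1 - 1 / b) * ‖η (n + 1) - η n‖ := by
            rw [← mul_assoc, mul_right_comm, div_mul_cancel₀ _ hφ.ne']
        _ ≤ (1 - 1 / b) * ((1 - 1 / b) ^ n * ‖𝒦₁ φ‖) := by gcongr
        _ = (1 - 1 / b) ^ (n + 1) * ‖𝒦₁ φ‖ := by rw [pow_succ']; ring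
  refine ⟨hdecay, cauchySeq_of_le_geometric (1 - 1 / b) ‖𝒦₁ φ‖ hr1 fun n => ?_⟩
  rw [dist_comm, dist_eq_norm, mul_comm]
  exact hdecay n
end

section
/- Let X and Y be real Banach spaces, and let μ, ν > 0. Let K₁ : X → Y be a bounded linear operator with ‖K₁‖ ≤ ν, let K₂ : X × X → Y be a continuous bilinear map with ‖K₂‖ ≤ ν·μ, and let 𝒦₁ : Y → X be a bounded linear operator. Define continuous multilinear maps K̃_n : Yⁿ → X by: K̃₁ = 𝒦₁; K̃₂(φ₁,φ₂) = −𝒦₁(K₂(𝒦₁φ₁, 𝒦₁φ₂)); and for j ≥ 3, K̃_j(φ₁,…,φ_j) = −K̃_{j−1}(K₂(𝒦₁φ₁, 𝒦₁φ₂), K₁(𝒦₁φ₃), …, K₁(𝒦₁φ_j)). Then for every n ≥ 1 and all φ₁,…,φ_n ∈ Y, ‖K̃_n(φ₁,…,φ_n)‖ ≤ μ^{n−1} · ν^{n(n−1)/2} · ‖𝒦₁‖^{n(n+1)/2} · Π_{i=1}^n ‖φ_i‖; equivalently, ‖K̃_n‖ ≤ (1/μ)·(μ/ν)ⁿ·(ν‖𝒦₁‖)^{n(n+1)/2}.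 -/
/-- The terms of the reduced inverse Born series, with index shift:
`redK K₁ K₂ 𝒦₁ n = K̃_{n+1}`.  Explicitly `K̃₁ = 𝒦₁`,
`K̃₂(φ₁, φ₂) = -𝒦₁(K₂(𝒦₁φ₁, 𝒦₁φ₂))`, and for `j ≥ 3`
`K̃_j(φ₁, …, φ_j) = -K̃_{j-1}(K₂(𝒦₁φ₁, 𝒦₁φ₂), K₁(𝒦₁φ₃), …, K₁(𝒦₁φ_j))`. -/
noncomputable def redK {X Y : Type*} [NormedAddCommGroup X] [NormedSpace ℝ X]
    [NormedAddCommGroup Y] [NormedSpace ℝ Y]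
    (K₁ : X →L[ℝ] Y) (K₂ : X →L[ℝ] X →L[ℝ] Y) (𝒦₁ : Y →L[ℝ] X) :
    (n : ℕ) → (Fin (n + 1) → Y) → X
  | 0, φ => 𝒦₁ (φ 0)
  | 1, φ => -𝒦₁ (K₂ (𝒦₁ (φ 0)) (𝒦₁ (φ 1)))
  | n + 2, φ => -redK K₁ K₂ 𝒦₁ (n + 1)
      (Fin.cons (K₂ (𝒦₁ (φ 0)) (𝒦₁ (φ 1)))
        (fun i : Fin (n + 1) => K₁ (𝒦₁ (φ i.succ.succ))))

theorem norm_apply_comp_le {X Y : Type*} [NormedAddCommGroup X] [NormedSpace ℝ X]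
    [NormedAddCommGroup Y] [NormedSpace ℝ Y] {C : ℝ}
    (K₂ : X →L[ℝ] X →L[ℝ] Y) (hK₂ : ‖K₂‖ ≤ C) (T : Y →L[ℝ] X) (a b : Y) :
    ‖K₂ (T a) (T b)‖ ≤ C * ‖T‖ ^ 2 * (‖a‖ * ‖b‖) := by
  have hC : 0 ≤ C := (norm_nonneg K₂).trans hK₂
  calc ‖K₂ (T a) (T b)‖ ≤ ‖K₂‖ * ‖T a‖ * ‖T b‖ := K₂.le_opNorm₂ _ _
    _ ≤ C * (‖T‖ * ‖a‖) * (‖T‖ * ‖b‖) := by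
        gcongr
        · exact T.le_opNorm a
        · exact T.le_opNorm b
    _ = C * ‖T‖ ^ 2 * (‖a‖ * ‖b‖) := by ring

/-- **Norm bound for the reduced inverse Born series operators.**  If `‖K₁‖ ≤ ν` and
`‖K₂‖ ≤ ν·μ`, then for every `n ≥ 1` (here `n + 1` with `n : ℕ`)
`‖K̃_{n+1}(φ₁, …, φ_{n+1})‖ ≤ μⁿ · ν^{(n+1)n/2} · ‖𝒦₁‖^{(n+1)(n+2)/2} · Π ‖φᵢ‖`,
i.e. `‖K̃_m‖ ≤ μ^{m-1} ν^{m(m-1)/2} ‖𝒦₁‖^{m(m+1)/2} = (1/μ)(μ/ν)^m (ν‖𝒦₁‖)^{m(m+1)/2}`. -/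
theorem stmt_4 {X Y : Type*} [NormedAddCommGroup X] [NormedSpace ℝ X] [CompleteSpace X]
    [NormedAddCommGroup Y] [NormedSpace ℝ Y] [CompleteSpace Y]
    (μ ν : ℝ) (hμ : 0 < μ) (hν : 0 < ν)
    (K₁ : X →L[ℝ] Y) (hK₁ : ‖K₁‖ ≤ ν)
    (K₂ : X →L[ℝ] X →L[ℝ] Y) (hK₂ : ‖K₂‖ ≤ ν * μ)
    (𝒦₁ : Y →L[ℝ] X) :
    ∀ (n : ℕ) (φ : Fin (n + 1) → Y),
      ‖redK K₁ K₂ 𝒦₁ n φ‖ ≤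
        μ ^ n * ν ^ ((n + 1) * n / 2) * ‖𝒦₁‖ ^ ((n + 1) * (n + 2) / 2) *
          ∏ i : Fin (n + 1), ‖φ i‖ := by
  intro n
  induction n with
  | zero =>
    intro φ
    simpa [redK] using 𝒦₁.le_opNorm (φ 0)
  | succ n ih =>
    intro φ
    have hB := norm_apply_comp_le K₂ hK₂ 𝒦₁ (φ 0) (φ 1)
    cases n with
    | zero =>
      simp only [redK, norm_neg]
      calc ‖𝒦₁ (K₂ (𝒦₁ (φ 0)) (𝒦₁ (φ 1)))‖
          ≤ ‖𝒦₁‖ * (ν * μ * ‖𝒦₁‖ ^ 2 * (‖φ 0‖ * ‖φ 1‖)) := 𝒦₁.le_opNorm_of_le hB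
        _ = _ := by
          simp [Fin.prod_univ_two]
          ring
    | succ n =>
      have hν_exp : (n + 1 + 1 + 1) * (n + 1 + 1) / 2 = (n + 1 + 1) * (n + 1) / 2 + (n + 2) := by
        rw [← Nat.add_mul_div_left _ _ two_pos]
        ring_nf
      have hk_exp : (n + 1 + 1 + 1) * (n + 1 + 1 + 2) / 2
          = (n + 1 + 1) * (n + 1 + 2) / 2 + (n + 3) := by
        rw [← Nat.add_mul_div_left _ _ two_pos]
        ring_nf
      have hprod : ∏ i : Fin (n + 1), ‖K₁ (𝒦₁ (φ i.succ.succ))‖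
          ≤ (ν * ‖𝒦₁‖) ^ (n + 1) * ∏ i : Fin (n + 1), ‖φ i.succ.succ‖ := by
        calc _ ≤ ∏ i : Fin (n + 1), ν * ‖𝒦₁‖ * ‖φ i.succ.succ‖ := by
              gcongr with i
              rw [mul_assoc]
              exact (K₁.le_of_opNorm_le hK₁ _).trans (by gcongr; exact 𝒦₁.le_opNorm _)
          _ = _ := by simp [Finset.prod_mul_distrib]
      rw [redK, norm_neg]
      refine (ih _).trans ?_
      rw [hν_exp, hk_exp, Fin.prod_univ_succ, Fin.prod_univ_succ (n := n + 1 + 1),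
        Fin.prod_univ_succ (n := n + 1)]
      simp only [Fin.cons_zero, Fin.cons_succ, Fin.succ_zero_eq_one]
      calc _ ≤ μ ^ (n + 1) * ν ^ ((n + 1 + 1) * (n + 1) / 2)
              * ‖𝒦₁‖ ^ ((n + 1 + 1) * (n + 1 + 2) / 2)
              * (ν * μ * ‖𝒦₁‖ ^ 2 * (‖φ 0‖ * ‖φ 1‖)
                * ((ν * ‖𝒦₁‖) ^ (n + 1) * ∏ i : Fin (n + 1), ‖φ i.succ.succ‖)) := by
            gcongr
        _ = _ := by
            rw [pow_add ν, pow_add ‖𝒦₁‖, mul_pow]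
            ring
end

section
/- Let X and Y be real Banach spaces, and let μ, ν > 0. Let K₁ : X → Y be a bounded linear operator with ‖K₁‖ ≤ ν, let K₂ : X × X → Y be a continuous bilinear map with ‖K₂‖ ≤ ν·μ, and let 𝒦₁ : Y → X be a bounded linear operator. Define K̃₁ = 𝒦₁; K̃₂(φ₁,φ₂) = −𝒦₁(K₂(𝒦₁φ₁, 𝒦₁φ₂)); and for j ≥ 3, K̃_j(φ₁,…,φ_j) = −K̃_{j−1}(K₂(𝒦₁φ₁, 𝒦₁φ₂), K₁(𝒦₁φ₃), …, K₁(𝒦₁φ_j)). Assume there exists M ∈ (0,1) with ν·‖𝒦₁‖ ≤ M, and let φ ∈ Y satisfy (μ/ν)·‖φ‖ < 1. Then the reduced inverse Born series converges absolutely: Σ_{n=1}^∞ ‖K̃_n(φ,…,φ)‖ ≤ (1/μ)·Σ_{n=1}^∞ M^{n(n+1)/2}·((μ/ν)‖φ‖)ⁿ < ∞, so that Σ_{n=1}^∞ K̃_n(φ,…,φ) converges in X. -/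
section

variable {X Y : Type*} [NormedAddCommGroup X] [NormedSpace ℝ X]
  [NormedAddCommGroup Y] [NormedSpace ℝ Y]

theorem redK_succ (K₁ : X →L[ℝ] Y) (K₂ : X →L[ℝ] X →L[ℝ] Y) (𝒦₁ : Y →L[ℝ] X) (n : ℕ)
    (φ : Fin (n + 2) → Y) :
    redK K₁ K₂ 𝒦₁ (n + 1) φ = -redK K₁ K₂ 𝒦₁ n
      (Fin.cons (K₂ (𝒦₁ (φ 0)) (𝒦₁ (φ 1))) (fun i : Fin n => K₁ (𝒦₁ (φ i.succ.succ)))) := by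
  cases n <;> simp [redK]

theorem succ_triangle_exponent (n : ℕ) :
    (n + 1 + 1) * (n + 1 + 2) / 2 = (n + 1) * (n + 2) / 2 + (n + 2) := by
  rw [show (n + 1 + 1) * (n + 1 + 2) = (n + 1) * (n + 2) + (n + 2) * 2 by ring,
    Nat.add_mul_div_right _ _ two_pos]

theorem norm_redK_le {μ ν M : ℝ} (hμ : 0 < μ) (hν : 0 < ν)
    {K₁ : X →L[ℝ] Y} (hK₁ : ‖K₁‖ ≤ ν) {K₂ : X →L[ℝ] X →L[ℝ] Y} (hK₂ : ‖K₂‖ ≤ ν * μ)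
    {𝒦₁ : Y →L[ℝ] X} (hM0 : 0 < M) (h𝒦₁ : ν * ‖𝒦₁‖ ≤ M) (n : ℕ) (φ : Fin (n + 1) → Y) :
    ‖redK K₁ K₂ 𝒦₁ n φ‖ ≤
      1 / μ * (M ^ ((n + 1) * (n + 2) / 2) * ((μ / ν) ^ (n + 1) * ∏ i, ‖φ i‖)) := by
  have h𝒦 (y : Y) : ‖𝒦₁ y‖ ≤ M / ν * ‖y‖ :=
    𝒦₁.le_of_opNorm_le ((le_div_iff₀' hν).2 h𝒦₁) y
  induction n with
  | zero =>
    have h : μ⁻¹ * (M * (μ / ν * ‖φ 0‖)) = M / ν * ‖φ 0‖ := by field_simp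
    simpa [redK, h] using h𝒦 (φ 0)
  | succ n ih =>
    have h₂ : ‖K₂ (𝒦₁ (φ 0)) (𝒦₁ (φ 1))‖ ≤ μ / ν * M ^ 2 * (‖φ 0‖ * ‖φ 1‖) := by
      calc ‖K₂ (𝒦₁ (φ 0)) (𝒦₁ (φ 1))‖ ≤ ‖K₂‖ * ‖𝒦₁ (φ 0)‖ * ‖𝒦₁ (φ 1)‖ := K₂.le_opNorm₂ _ _
        _ ≤ ν * μ * (M / ν * ‖φ 0‖) * (M / ν * ‖φ 1‖) := by
          gcongr
          · exact h𝒦 _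
          · exact h𝒦 _
        _ = μ / ν * M ^ 2 * (‖φ 0‖ * ‖φ 1‖) := by field_simp
    have h₁ (y : Y) : ‖K₁ (𝒦₁ y)‖ ≤ M * ‖y‖ := by
      calc ‖K₁ (𝒦₁ y)‖ ≤ ν * ‖𝒦₁ y‖ := K₁.le_of_opNorm_le hK₁ _
        _ ≤ ν * (M / ν * ‖y‖) := by gcongr; exact h𝒦 y
        _ = M * ‖y‖ := by field_simp
    have hprod : ∏ i : Fin n, ‖K₁ (𝒦₁ (φ i.succ.succ))‖ ≤
        M ^ n * ∏ i : Fin n, ‖φ i.succ.succ‖ := by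
      calc _ ≤ ∏ i : Fin n, M * ‖φ i.succ.succ‖ :=
            Finset.prod_le_prod (fun _ _ => norm_nonneg _) fun _ _ => h₁ _
        _ = _ := by simp [Finset.prod_mul_distrib]
    rw [redK_succ, norm_neg]
    refine (ih _).trans ?_
    rw [Fin.prod_univ_succ]
    simp only [Fin.cons_zero, Fin.cons_succ]
    calc _ ≤ 1 / μ * (M ^ ((n + 1) * (n + 2) / 2) * ((μ / ν) ^ (n + 1) *
          (μ / ν * M ^ 2 * (‖φ 0‖ * ‖φ 1‖) * (M ^ n * ∏ i : Fin n, ‖φ i.succ.succ‖)))) := by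
          gcongr
      _ = _ := by
          rw [succ_triangle_exponent, Fin.prod_univ_succ, Fin.prod_univ_succ, Fin.succ_zero_eq_one]
          ring

end

/-- **Proposition 6.4 (convergence of the reduced inverse Born series).**  If
`‖K₁‖ ≤ ν`, `‖K₂‖ ≤ ν·μ`, `ν‖𝒦₁‖ ≤ M` for some `M ∈ (0,1)`, and the data `φ`
satisfies `(μ/ν)‖φ‖ < 1`, then the reduced inverse Born series
`Σ_{n≥1} K̃_n(φ, …, φ)` converges absolutely, with
`Σ_{n≥1} ‖K̃_n(φ,…,φ)‖ ≤ (1/μ) Σ_{n≥1} M^{n(n+1)/2} ((μ/ν)‖φ‖)ⁿ < ∞`. -/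
theorem stmt_5 {X Y : Type*} [NormedAddCommGroup X] [NormedSpace ℝ X] [CompleteSpace X]
    [NormedAddCommGroup Y] [NormedSpace ℝ Y] [CompleteSpace Y]
    (μ ν : ℝ) (hμ : 0 < μ) (hν : 0 < ν)
    (K₁ : X →L[ℝ] Y) (hK₁ : ‖K₁‖ ≤ ν)
    (K₂ : X →L[ℝ] X →L[ℝ] Y) (hK₂ : ‖K₂‖ ≤ ν * μ)
    (𝒦₁ : Y →L[ℝ] X)
    (M : ℝ) (hM0 : 0 < M) (hM1 : M < 1) (h𝒦₁ : ν * ‖𝒦₁‖ ≤ M)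
    (φ : Y) (hφ : μ / ν * ‖φ‖ < 1) :
    Summable (fun n : ℕ => ‖redK K₁ K₂ 𝒦₁ n (fun _ => φ)‖) ∧
    Summable (fun n : ℕ => M ^ ((n + 1) * (n + 2) / 2) * (μ / ν * ‖φ‖) ^ (n + 1)) ∧
    (∑' n : ℕ, ‖redK K₁ K₂ 𝒦₁ n (fun _ => φ)‖) ≤
      1 / μ * ∑' n : ℕ, M ^ ((n + 1) * (n + 2) / 2) * (μ / ν * ‖φ‖) ^ (n + 1) ∧
    Summable (fun n : ℕ => redK K₁ K₂ 𝒦₁ n (fun _ => φ)) := by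
  have hr : 0 ≤ μ / ν * ‖φ‖ := by positivity
  have hbound (n : ℕ) : ‖redK K₁ K₂ 𝒦₁ n (fun _ => φ)‖ ≤
      1 / μ * (M ^ ((n + 1) * (n + 2) / 2) * (μ / ν * ‖φ‖) ^ (n + 1)) := by
    simpa [mul_pow] using norm_redK_le hμ hν hK₁ hK₂ hM0 h𝒦₁ n (fun _ => φ)
  have hmaj : Summable
      (fun n : ℕ => M ^ ((n + 1) * (n + 2) / 2) * (μ / ν * ‖φ‖) ^ (n + 1)) :=
    Summable.of_nonneg_of_le (fun n => by positivity)
      (fun n => mul_le_of_le_one_left (by positivity) (pow_le_one₀ hM0.le hM1.le))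
      ((summable_nat_add_iff 1).2 (summable_geometric_of_lt_one hr hφ))
  have hsum : Summable (fun n : ℕ => ‖redK K₁ K₂ 𝒦₁ n (fun _ => φ)‖) :=
    Summable.of_nonneg_of_le (fun _ => norm_nonneg _) hbound (hmaj.mul_left _)
  refine ⟨hsum, hmaj, ?_, hsum.of_norm⟩
  rw [← tsum_mul_left]
  exact hsum.tsum_le_tsum hbound (hmaj.mul_left _)
end

section
/- Let X and Y be real Banach spaces. For each j ≥ 1 let K_j : X^j → Y be a continuous multilinear map. For a bounded linear operator 𝒦₁ : Y → X write ε(𝒦₁) := ‖𝒦₁∘K₁ − I‖ (operator norm on X), and define the inverse Born series operators 𝒦_j = 𝒦_j(𝒦₁) : Y^j → X recursively by 𝒦₁(φ) = 𝒦₁φ and, for j ≥ 2, 𝒦_j(φ₁,…,φ_j) = −Σ_{m=1}^{j−1} Σ_{(i₁,…,i_m)} 𝒦_m( K_{i₁}(𝒦₁φ₁,…,𝒦₁φ_{i₁}), K_{i₂}(𝒦₁φ_{i₁+1},…), …, K_{i_m}(…,𝒦₁φ_j) ), the inner sum running over all compositions (i₁,…,i_m) of j into m positive parts. Assume the insertion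 estimate: for every j ≥ 1 and n ≥ 1 there exists C₀(j,n) ≥ 0 such that for every bounded linear 𝒦₁ : Y → X and all ξ₁,…,ξ_{j+n} ∈ X, ‖K_{j+1}(ξ₁,…,ξ_j, 𝒦₁(K_n(ξ_{j+1},…,ξ_{j+n}))) − K_{j+n}(ξ₁,…,ξ_{j+n})‖ ≤ C₀(j,n)·ε(𝒦₁)·Π_k ‖ξ_k‖. Then for every n ≥ 2 and every R > 0 there exists a constant C such that for every bounded linear 𝒦₁ with ‖𝒦₁‖ ≤ R and all φ₁,…,φ_n ∈ Y: ‖𝒦_n(φ₁,…,φ_n) + 𝒦_{n−1}( K₂(𝒦₁φ₁, 𝒦₁φ₂), K₁(𝒦₁φ₃), …, K₁(𝒦₁φ_n) )‖ ≤ C·ε(𝒦₁)·Π_{i=1}^n ‖φ_i‖. -/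
/-- The inverse Born series operators `𝒦_j` associated to the forward operators
`K_j` and the regularized pseudoinverse `𝒦₁`: `𝒦₁(φ) = 𝒦₁ φ` and, for `j ≥ 2`,
`𝒦_j(φ₁,…,φ_j) = -Σ_{m=1}^{j-1} Σ_{i₁+⋯+i_m=j} 𝒦_m(K_{i₁}(𝒦₁φ₁,…), …, K_{i_m}(…,𝒦₁φ_j))`,
the inner sum over all compositions of `j` into `m` positive parts (equivalently, over
all compositions `c` of `j` of length `< j`). -/
noncomputable def invBorn {X Y : Type*} [NormedAddCommGroup X] [NormedSpace ℝ X]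
    [NormedAddCommGroup Y] [NormedSpace ℝ Y]
    (K : (j : ℕ) → ContinuousMultilinearMap ℝ (fun _ : Fin j => X) Y)
    (𝒦₁ : Y →L[ℝ] X) : (j : ℕ) → (Fin j → Y) → X
  | 0 => fun _ => 0
  | 1 => fun φ => 𝒦₁ (φ 0)
  | j + 2 => fun φ =>
      -∑ c ∈ (Finset.univ.filter fun c : Composition (j + 2) => c.length < j + 2).attach,
        invBorn K 𝒦₁ c.1.length
          (fun i => K (c.1.blocksFun i) (fun l => 𝒦₁ (φ (c.1.embedding i l))))
  termination_by j => j
  decreasing_by exact (Finset.mem_filter.mp c.2).2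

/-- `ε(𝒦₁) = ‖𝒦₁ ∘ K₁ - I‖`, the operator norm (on `X`) measuring how far the
regularized pseudoinverse `𝒦₁` is from a true left inverse of `K₁`. -/
noncomputable def epsIBS {X Y : Type*} [NormedAddCommGroup X] [NormedSpace ℝ X]
    [NormedAddCommGroup Y] [NormedSpace ℝ Y]
    (K : (j : ℕ) → ContinuousMultilinearMap ℝ (fun _ : Fin j => X) Y)
    (𝒦₁ : Y →L[ℝ] X) : ℝ :=
  ‖𝒦₁.comp (continuousMultilinearCurryFin1 ℝ X Y (K 1)) - ContinuousLinearMap.id ℝ X‖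

namespace InverseBorn

open Asymptotics Filter Finset

/-- Add the first two entries of a list. -/
def mergeList : List ℕ → List ℕ
  | a :: b :: t => (a + b) :: t
  | l => l

/-- Split a `1` off the first entry of a list, if that entry is at least two. -/
def splitList : List ℕ → List ℕ
  | (a + 2) :: t => 1 :: (a + 1) :: t
  | l => l

/-- Merge the first two blocks of a composition. -/
def mergeComp {n : ℕ} (c : Composition n) : Composition n where
  blocks := mergeList c.blocks
  blocks_pos := by
    obtain ⟨l, hl, -⟩ := c
    rcases l with _ | ⟨a, _ | ⟨b, t⟩⟩ <;> simp_all [mergeList]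
  blocks_sum := by
    obtain ⟨l, -, hs⟩ := c
    rcases l with _ | ⟨a, _ | ⟨b, t⟩⟩ <;> simp [mergeList, ← hs, add_assoc]

/-- Split a block of size one off the first block of a composition, if that block has size at
least two. -/
def splitComp {n : ℕ} (c : Composition n) : Composition n where
  blocks := splitList c.blocks
  blocks_pos := by
    obtain ⟨l, hl, -⟩ := c
    rcases l with _ | ⟨_ | _ | a, t⟩ <;> simp_all [splitList]
  blocks_sum := by
    obtain ⟨l, -, hs⟩ := c
    rcases l with _ | ⟨_ | _ | a, t⟩ <;> simp [splitList, ← hs]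
    omega

/-- The sizes of the blocks of a composition, extended by zero. -/
def blockSize {n : ℕ} (c : Composition n) (k : ℕ) : ℕ := c.blocks.getD k 0

/-- Add the first two terms of a sequence. -/
def mergeSeq (s : ℕ → ℕ) : ℕ → ℕ
  | 0 => s 0 + s 1
  | k + 1 => s (k + 2)

theorem sum_range_mergeSeq (s : ℕ → ℕ) (m : ℕ) :
    ∑ r ∈ range (m + 1), mergeSeq s r = ∑ r ∈ range (m + 2), s r := by
  rw [sum_range_succ', sum_range_succ' s, sum_range_succ' (fun k => s (k + 1))]
  simp only [mergeSeq]
  ring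

theorem blockSize_of_lt {n : ℕ} (c : Composition n) {i : ℕ} (hi : i < c.length) :
    blockSize c i = c.blocksFun ⟨i, hi⟩ := by
  have hi' : i < c.blocks.length := hi
  simp [blockSize, Composition.blocksFun, hi']

theorem sizeUpTo_eq_sum_blockSize {n : ℕ} (c : Composition n) (k : ℕ) :
    c.sizeUpTo k = ∑ r ∈ range k, blockSize c r := by
  unfold Composition.sizeUpTo blockSize
  induction k with
  | zero => simp
  | succ k ih =>
    rw [sum_range_succ, ← ih]
    rcases lt_or_ge k c.blocks.length with h | h
    · simp [List.sum_take_succ, h]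
    · rw [List.take_of_length_le h, List.take_of_length_le (by omega)]
      simp [h]

theorem exists_blocks_eq_one_cons {n : ℕ} (hn : 2 ≤ n) {c : Composition n}
    (hc : blockSize c 0 = 1) : ∃ b t, c.blocks = 1 :: (b + 1) :: t := by
  obtain ⟨l, hl, rfl⟩ := c
  rcases l with _ | ⟨a, _ | ⟨_ | b, t⟩⟩ <;> simp_all [blockSize]
  exact absurd (hl (i := 0) (by simp)) (lt_irrefl _)

theorem exists_blocks_eq_add_two_cons {n : ℕ} (hn : 2 ≤ n) {c : Composition n}
    (hc : blockSize c 0 ≠ 1) : ∃ a t, c.blocks = (a + 2) :: t := by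
  obtain ⟨l, hl, rfl⟩ := c
  rcases l with _ | ⟨_ | _ | a, t⟩ <;> simp_all [blockSize]
  exact absurd (hl (i := 0) (by simp)) (lt_irrefl _)

theorem blocks_mergeComp {n : ℕ} {c : Composition n} {a b : ℕ} {t : List ℕ}
    (h : c.blocks = a :: b :: t) : (mergeComp c).blocks = (a + b) :: t := by
  simp [mergeComp, h, mergeList]

theorem blockSize_mergeComp {n : ℕ} {c : Composition n} {a b : ℕ} {t : List ℕ}
    (h : c.blocks = a :: b :: t) : blockSize (mergeComp c) = mergeSeq (blockSize c) := by
  funext k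
  cases k <;> simp [blockSize, blocks_mergeComp h, h, mergeSeq]

theorem sum_comp_length_lt {M : Type*} [AddCommGroup M] {n : ℕ} (hn : 2 ≤ n)
    (T : Composition n → M) :
    ∑ c with c.length < n, T c = T (mergeComp (Composition.ones n)) +
      ∑ c with blockSize c 0 = 1 ∧ c.length < n, (T c + T (mergeComp c)) := by
  have hmerge : ∑ c with blockSize c 0 = 1, T (mergeComp c) = ∑ c with blockSize c 0 ≠ 1, T c := by
    refine sum_bij' (fun c _ => mergeComp c) (fun c _ => splitComp c) ?_ ?_ ?_ ?_ (fun _ _ => rfl)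
    · intro c hc
      obtain ⟨b, t, h⟩ := exists_blocks_eq_one_cons hn (by simpa using hc)
      simp [blockSize, blocks_mergeComp h]
    · intro c hc
      obtain ⟨a, t, h⟩ := exists_blocks_eq_add_two_cons hn (by simpa using hc)
      simp [blockSize, splitComp, h, splitList]
    · intro c hc
      obtain ⟨b, t, h⟩ := exists_blocks_eq_one_cons hn (by simpa using hc)
      ext1
      simp only [splitComp, blocks_mergeComp h, h]
      simp [add_comm 1, splitList]
    · intro c hc
      obtain ⟨a, t, h⟩ := exists_blocks_eq_add_two_cons hn (by simpa using hc)
      ext1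
      simp only [mergeComp, splitComp, h, splitList, mergeList]
      simp [add_comm 1]
  have hones : blockSize (Composition.ones n) 0 = 1 := by
    have : 0 < (Composition.ones n).length := by simp; omega
    rw [blockSize_of_lt _ this, Composition.ones_blocksFun]
  have hlt : ∀ c : Composition n, blockSize c 0 ≠ 1 → c.length < n := by
    intro c hc
    refine lt_of_le_of_ne c.length_le fun h => hc ?_
    rw [Composition.eq_ones_iff_length.2 h, hones]
  have hsplit : ∑ c with blockSize c 0 = 1, T (mergeComp c) =
      T (mergeComp (Composition.ones n)) +
        ∑ c with blockSize c 0 = 1 ∧ c.length < n, T (mergeComp c) := by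
    rw [← sum_insert (f := fun c => T (mergeComp c)) (by simp)]
    congr 1
    ext c
    simp only [mem_filter, mem_univ, true_and, mem_insert, Composition.eq_ones_iff_length]
    have := c.length_le
    constructor
    · intro h
      by_cases hh : c.length = n
      · exact .inl hh
      · exact .inr ⟨h, by omega⟩
    · rintro (h | h)
      · rw [Composition.eq_ones_iff_length.2 h, hones]
      · exact h.1
  rw [sum_add_distrib, add_left_comm, ← hsplit, hmerge,
    ← sum_filter_add_sum_filter_not _ (fun c => blockSize c 0 = 1), filter_filter, filter_filter]
  congr 2
  · ext c
    simp [and_comm]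
  · ext c
    simpa using hlt c

variable {X : Type*} [NormedAddCommGroup X] [NormedSpace ℝ X]

/-- The inverse Born series attached to the formal series `p = 𝒦₁ ∘ K`, as multilinear maps in the
variables `ξ = 𝒦₁ φ`. -/
noncomputable def invSeries (p : FormalMultilinearSeries ℝ X X) : FormalMultilinearSeries ℝ X X
  | 0 => 0
  | 1 => (continuousMultilinearCurryFin1 ℝ X X).symm (ContinuousLinearMap.id ℝ X)
  | n + 2 =>
      -∑ c ∈ (Finset.univ.filter fun c : Composition (n + 2) => c.length < n + 2).attach,
        (invSeries p c.1.length).compAlongComposition p c.1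
  termination_by n => n
  decreasing_by exact (Finset.mem_filter.mp c.2).2

/-- Feed consecutive blocks of sizes `s 0, s 1, …` of the sequence `ξ` to a formal series. -/
noncomputable def blockEval (p : FormalMultilinearSeries ℝ X X) (s : ℕ → ℕ) (ξ : ℕ → X)
    (k : ℕ) : X :=
  p (s k) fun l => ξ (∑ r ∈ range k, s r + l)

theorem invSeries_add_two (p : FormalMultilinearSeries ℝ X X) (n : ℕ) (ξ : ℕ → X) :
    invSeries p (n + 2) (fun i => ξ i) = -∑ c : Composition (n + 2) with c.length < n + 2,
      invSeries p c.length (fun i => blockEval p (blockSize c) ξ i) := by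
  rw [invSeries, neg_apply, _root_.sum_apply,
    sum_attach _ (fun c : Composition (n + 2) =>
      ((invSeries p c.length).compAlongComposition p c) (fun i => ξ i))]
  congr 1
  refine sum_congr rfl fun c _ => ?_
  rw [ContinuousMultilinearMap.compAlongComposition_apply]
  congr 1
  funext i
  refine p.congr (blockSize_of_lt c i.2).symm fun j h₁ h₂ => ?_
  simp [Composition.coe_embedding, sizeUpTo_eq_sum_blockSize]

theorem prod_range_sum {M : Type*} [CommMonoid M] (f : ℕ → M) (s : ℕ → ℕ) (m : ℕ) :
    ∏ k ∈ range m, ∏ l ∈ range (s k), f (∑ r ∈ range k, s r + l) =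
      ∏ l ∈ range (∑ r ∈ range m, s r), f l := by
  induction m with
  | zero => simp
  | succ m ih => rw [prod_range_succ, ih, sum_range_succ, prod_range_add]

theorem isBigO_multilinear {α : Type*} {l : Filter α} {m : ℕ}
    {A : α → ContinuousMultilinearMap ℝ (fun _ : Fin m => X) X} {u : α → ℕ → X} {w : α → ℕ → ℝ}
    (hA : A =O[l] fun _ => (1 : ℝ)) (hu : ∀ k, (fun a => u a k) =O[l] fun a => w a k) :
    (fun a => A a (fun i => u a i)) =O[l] fun a => ∏ k ∈ range m, w a k := by
  have h : (fun a => ‖A a‖ * ∏ i : Fin m, ‖u a i‖) =O[l] fun a => 1 * ∏ i : Fin m, w a i :=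
    hA.norm_left.mul (.finsetProd fun i _ => (hu i).norm_left)
  simp only [one_mul, fun a => Fin.prod_univ_eq_prod_range (w a) m] at h
  exact (IsBigO.of_norm_le fun a => (A a).le_opNorm _).trans h

theorem isBigO_multilinear_sub {α : Type*} {l : Filter α} {m : ℕ}
    {A : α → ContinuousMultilinearMap ℝ (fun _ : Fin m => X) X} {u v : α → ℕ → X}
    {w : α → ℕ → ℝ} {ε : α → ℝ}
    (hA : A =O[l] fun _ => (1 : ℝ)) (hu : ∀ k, (fun a => u a k) =O[l] fun a => w a k)
    (hv : ∀ k, (fun a => v a k) =O[l] fun a => w a k)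
    (huv : ∀ k, (fun a => u a k - v a k) =O[l] fun a => ε a * w a k) :
    (fun a => A a (fun i => u a i) - A a (fun i => v a i)) =O[l]
      fun a => ε a * ∏ k ∈ range m, w a k := by
  have h : (fun a => ‖A a‖ * ∑ i : Fin m, ∏ j : Fin m,
      if j = i then ‖u a i - v a i‖ else max ‖u a j‖ ‖v a j‖) =O[l]
        fun a => 1 * (ε a * ∏ i : Fin m, w a i) := by
    refine hA.norm_left.mul (.fun_sum fun i _ => ?_)
    have : ∀ a, ε a * ∏ j : Fin m, w a j = ∏ j, (if j = i then ε a else 1) * w a j := by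
      intro a
      rw [prod_mul_distrib, prod_ite_eq' univ i]
      simp
    simp only [this]
    refine .finsetProd fun j _ => ?_
    by_cases hj : j = i
    · subst hj
      simpa using (huv j).norm_left
    · simp only [hj, if_false, one_mul]
      refine IsBigO.trans (.of_norm_le fun a => ?_) ((hu j).norm_left.add (hv j).norm_left)
      rw [Real.norm_of_nonneg (by positivity)]
      exact max_le_add_of_nonneg (norm_nonneg _) (norm_nonneg _)
  simp only [one_mul, fun a => Fin.prod_univ_eq_prod_range (w a) m] at h
  exact (IsBigO.of_norm_le fun a => (A a).norm_image_sub_le' _ _).trans h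

theorem isBigO_invSeries {ι : Type*} {P : ι → FormalMultilinearSeries ℝ X X}
    (hP : ∀ n, (fun i => P i n) =O[⊤] fun _ => (1 : ℝ)) (n : ℕ) :
    (fun i => invSeries (P i) n) =O[⊤] fun _ => (1 : ℝ) := by
  induction n using Nat.strong_induction_on with
  | _ n ih =>
    match n with
    | 0 => simp only [invSeries]; exact isBigO_zero _ _
    | 1 => simp only [invSeries]; exact isBigO_const_const _ one_ne_zero _
    | n + 2 =>
      simp only [invSeries]
      refine IsBigO.neg_left (.fun_sum fun c _ => ?_)
      have h : (fun i => ‖invSeries (P i) c.1.length‖ * ∏ j, ‖P i (c.1.blocksFun j)‖) =O[⊤]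
          fun _ => (1 : ℝ) * ∏ _j : Fin c.1.length, (1 : ℝ) :=
        (ih _ (mem_filter.mp c.2).2).norm_left.mul (.finsetProd fun j _ => (hP _).norm_left)
      simp only [one_mul, prod_const_one] at h
      exact (IsBigO.of_norm_le fun i =>
        (invSeries (P i)).compAlongComposition_norm (P i) c.1).trans h

theorem blockEval_mergeSeq_succ (p : FormalMultilinearSeries ℝ X X) (s : ℕ → ℕ) (ξ : ℕ → X)
    (k : ℕ) : blockEval p (mergeSeq s) ξ (k + 1) = blockEval p s ξ (k + 2) := by
  simp only [blockEval, sum_range_mergeSeq]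
  rfl

theorem blockEval_one (p : FormalMultilinearSeries ℝ X X) (ξ : ℕ → X) (k : ℕ) :
    blockEval p (fun _ => 1) ξ k = p 1 fun _ => ξ k := by
  simp [blockEval]

theorem isBigO_blockEval {ι : Type*} {P : ι → FormalMultilinearSeries ℝ X X}
    (hP : ∀ n, (fun i => P i n) =O[⊤] fun _ => (1 : ℝ)) (s : ℕ → ℕ) (k : ℕ) :
    (fun q : ι × (ℕ → X) => blockEval (P q.1) s q.2 k) =O[⊤]
      fun q => ∏ l ∈ range (s k), ‖q.2 (∑ r ∈ range k, s r + l)‖ :=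
  isBigO_multilinear (A := fun q : ι × (ℕ → X) => P q.1 (s k))
    (u := fun q l => q.2 (∑ r ∈ range k, s r + l))
    ((hP (s k)).comp_tendsto (k := Prod.fst) tendsto_top) fun _ => (isBigO_refl _ _).norm_right

section Reduction

variable {ι : Type*} {P : ι → FormalMultilinearSeries ℝ X X} {ε : ι → ℝ}

theorem isBigO_reduce_sub_merge
    (hP : ∀ n, (fun i => P i n) =O[⊤] fun _ => (1 : ℝ))
    (hone : (fun q : ι × X => P q.1 1 (fun _ => q.2) - q.2) =O[⊤] fun q => ε q.1 * ‖q.2‖)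
    (hins : ∀ b, 1 ≤ b → (fun q : ι × (ℕ → X) =>
      P q.1 2 ![q.2 0, P q.1 b (fun l => q.2 (1 + l))] - P q.1 (1 + b) (fun l => q.2 l)) =O[⊤]
        fun q => ε q.1 * ∏ l ∈ range (1 + b), ‖q.2 l‖)
    {s : ℕ → ℕ} (h0 : s 0 = 1) (h1 : 1 ≤ s 1) (k : ℕ) :
    (fun q : ι × (ℕ → X) => blockEval (P q.1) (mergeSeq fun _ => 1) (blockEval (P q.1) s q.2) k -
      blockEval (P q.1) (mergeSeq s) q.2 k) =O[⊤] fun q => ε q.1 *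
        ∏ l ∈ range (mergeSeq s k), ‖q.2 (∑ r ∈ range k, mergeSeq s r + l)‖ := by
  have hsub (k : ℕ) : (fun q : ι × (ℕ → X) =>
      P q.1 1 (fun _ => blockEval (P q.1) s q.2 k) - blockEval (P q.1) s q.2 k) =O[⊤]
        fun q => ε q.1 * ∏ l ∈ range (s k), ‖q.2 (∑ r ∈ range k, s r + l)‖ :=
    (hone.comp_tendsto (k := fun q : ι × (ℕ → X) => (q.1, blockEval (P q.1) s q.2 k))
      tendsto_top).trans ((isBigO_refl _ _).mul (isBigO_blockEval hP s k).norm_left)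
  cases k with
  | succ k =>
    have h := hsub (k + 2)
    simp only [← sum_range_mergeSeq] at h
    simp only [blockEval_mergeSeq_succ, blockEval_one]
    exact h
  | zero =>
    have hblock0 : ∀ q : ι × (ℕ → X), blockEval (P q.1) s q.2 0 = P q.1 1 fun _ => q.2 0 :=
      fun q => (P q.1).congr h0 fun j hj hj' => by
        obtain rfl : j = 0 := by omega
        simp
    have hfst : (fun q : ι × (ℕ → X) => P q.1 1 (fun _ => q.2 0) - q.2 0) =O[⊤]
        fun q => ε q.1 * ‖q.2 0‖ :=
      hone.comp_tendsto (k := fun q : ι × (ℕ → X) => (q.1, q.2 0)) tendsto_top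
    let v : ι × (ℕ → X) → ℕ → X
      | q, 0 => q.2 0
      | q, k + 1 => blockEval (P q.1) s q.2 (k + 1)
    have hA : (fun q : ι × (ℕ → X) => P q.1 2) =O[⊤] fun _ => (1 : ℝ) :=
      (hP 2).comp_tendsto (k := Prod.fst) tendsto_top
    have h := isBigO_multilinear_sub (v := v) (ε := fun q => ε q.1) hA (isBigO_blockEval hP s)
      (by
        rintro (_ | k)
        · exact .of_norm_le fun q => by simp [v, h0]
        · exact isBigO_blockEval hP s (k + 1))
      (by
        rintro (_ | k)
        · simpa [v, h0, hblock0] using hfst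
        · exact (isBigO_zero _ _).congr_left fun q => by simp [v])
    have hrange : ∀ q : ι × (ℕ → X), ∏ k ∈ range 2, ∏ l ∈ range (s k),
        ‖q.2 (∑ r ∈ range k, s r + l)‖ = ∏ l ∈ range (1 + s 1), ‖q.2 l‖ := fun q => by
      rw [prod_range_sum (fun l => ‖q.2 l‖) s 2]
      simp [sum_range_succ, h0]
    simp only [hrange] at h
    refine (h.add (hins _ h1)).congr (fun q => ?_) fun q => ?_
    · have e1 : (fun i : Fin 2 => v q i) = ![q.2 0, P q.1 (s 1) (fun l => q.2 (1 + l))] := by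
        funext i
        fin_cases i
        · rfl
        · simp [v, blockEval, h0]
      have e2 : blockEval (P q.1) (mergeSeq s) q.2 0 = P q.1 (1 + s 1) fun l => q.2 l :=
        (P q.1).congr (by simp [mergeSeq, h0]) fun j hj hj' => by simp
      have e3 : blockEval (P q.1) (mergeSeq fun _ => 1) (blockEval (P q.1) s q.2) 0 =
          P q.1 2 fun i => blockEval (P q.1) s q.2 i :=
        (P q.1).congr rfl fun j hj hj' => by simp
      rw [e1, e2, e3]
      abel
    · simp [mergeSeq, h0]

theorem isBigO_invSeries_add_reduce
    (hP : ∀ n, (fun i => P i n) =O[⊤] fun _ => (1 : ℝ))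
    (hone : (fun q : ι × X => P q.1 1 (fun _ => q.2) - q.2) =O[⊤] fun q => ε q.1 * ‖q.2‖)
    (hε : ε =O[⊤] fun _ => (1 : ℝ))
    (hins : ∀ b, 1 ≤ b → (fun q : ι × (ℕ → X) =>
      P q.1 2 ![q.2 0, P q.1 b (fun l => q.2 (1 + l))] - P q.1 (1 + b) (fun l => q.2 l)) =O[⊤]
        fun q => ε q.1 * ∏ l ∈ range (1 + b), ‖q.2 l‖) (m : ℕ) :
    (fun q : ι × (ℕ → X) => invSeries (P q.1) (m + 2) (fun i => q.2 i) +
      invSeries (P q.1) (m + 1) (fun i => blockEval (P q.1) (mergeSeq fun _ => 1) q.2 i)) =O[⊤]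
        fun q => ε q.1 * ∏ k ∈ range (m + 2), ‖q.2 k‖ := by
  induction m using Nat.strong_induction_on with
  | _ m ih =>
  let T (q : ι × (ℕ → X)) (c : Composition (m + 2)) : X :=
    invSeries (P q.1) c.length (fun i => blockEval (P q.1) (blockSize c) q.2 i)
  have hT : ∀ (q : ι × (ℕ → X)) (c : Composition (m + 2)) (j : ℕ) (s : ℕ → ℕ), c.length = j →
      (∀ k < j, blockSize c k = s k) →
        T q c = invSeries (P q.1) j (fun i => blockEval (P q.1) s q.2 i) := by
    rintro q c _ s rfl hs
    simp only [T]
    congr 1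
    funext i
    refine (P q.1).congr (hs i i.2) fun j hj hj' => ?_
    rw [sum_congr rfl fun r hr => hs r ((mem_range.1 hr).trans i.2)]
  have hlead : ∀ q, T q (mergeComp (Composition.ones (m + 2))) = invSeries (P q.1) (m + 1)
      (fun i => blockEval (P q.1) (mergeSeq fun _ => 1) q.2 i) := by
    have hones : (Composition.ones (m + 2)).blocks = 1 :: 1 :: List.replicate m 1 := by
      simp [Composition.ones_blocks, List.replicate_succ]
    refine fun q => hT q _ _ _ ?_ ?_
    · rw [← Composition.blocks_length, blocks_mergeComp hones]
      simp
    · intro k hk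
      rw [blockSize_mergeComp hones]
      have : ∀ j < m + 2, blockSize (Composition.ones (m + 2)) j = 1 := fun j hj => by
        rw [blockSize_of_lt _ (by simpa using hj), Composition.ones_blocksFun]
      cases k with
      | zero => simp [mergeSeq, this]
      | succ k => simpa [mergeSeq] using this (k + 2) (by omega)
  have hpair : ∀ c : Composition (m + 2), blockSize c 0 = 1 → c.length < m + 2 →
      (fun q => T q c + T q (mergeComp c)) =O[⊤]
        fun q => ε q.1 * ∏ k ∈ range (m + 2), ‖q.2 k‖ := by
    intro c hc hlen
    obtain ⟨b, t, hb⟩ := exists_blocks_eq_one_cons (by omega) hc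
    have hj : c.length = t.length + 2 := by simp [← Composition.blocks_length, hb]
    have hj' : (mergeComp c).length = t.length + 1 := by
      simp [← Composition.blocks_length, blocks_mergeComp hb]
    have h1 : 1 ≤ blockSize c 1 := by simp [blockSize, hb]
    have htotal : ∑ r ∈ range (t.length + 2), blockSize c r = m + 2 := by
      rw [← hj, ← sizeUpTo_eq_sum_blockSize, Composition.sizeUpTo_length]
    have hsub := isBigO_reduce_sub_merge hP hone hins hc h1
    have hmerge := isBigO_blockEval hP (mergeSeq (blockSize c))
    have hε' : (fun q : ι × (ℕ → X) => ε q.1) =O[⊤] fun _ => (1 : ℝ) :=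
      hε.comp_tendsto (k := Prod.fst) tendsto_top
    have hred (k : ℕ) : (fun q : ι × (ℕ → X) =>
        blockEval (P q.1) (mergeSeq fun _ => 1) (blockEval (P q.1) (blockSize c) q.2) k) =O[⊤]
        fun q => ∏ l ∈ range (mergeSeq (blockSize c) k),
          ‖q.2 (∑ r ∈ range k, mergeSeq (blockSize c) r + l)‖ := by
      have := ((hsub k).trans (hε'.mul (isBigO_refl _ _))).congr_right fun q => one_mul _
      simpa using this.add (hmerge k)
    have hstep := isBigO_multilinear_sub (ε := fun q => ε q.1)
      ((isBigO_invSeries hP (t.length + 1)).comp_tendsto (k := Prod.fst) tendsto_top)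
      hred hmerge hsub
    have hih := ((ih t.length (by omega)).comp_tendsto
      (k := fun q : ι × (ℕ → X) => (q.1, blockEval (P q.1) (blockSize c) q.2)) tendsto_top).trans
      ((isBigO_refl _ _).mul (.finsetProd fun k _ =>
        (isBigO_blockEval hP (blockSize c) k).norm_left))
    simp only [fun q : ι × (ℕ → X) => prod_range_sum (fun l => ‖q.2 l‖), htotal,
      sum_range_mergeSeq] at hstep hih
    refine (hih.sub hstep).congr_left fun q => ?_
    rw [hT q c _ _ hj fun _ _ => rfl, hT q (mergeComp c) _ _ hj' fun k _ => by
      rw [blockSize_mergeComp hb]]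
    simp only [Function.comp_apply]
    abel
  have hsum : (fun q => ∑ c with blockSize c 0 = 1 ∧ c.length < m + 2,
      (T q c + T q (mergeComp c))) =O[⊤] fun q => ε q.1 * ∏ k ∈ range (m + 2), ‖q.2 k‖ :=
    .fun_sum fun c hc => hpair c (mem_filter.1 hc).2.1 (mem_filter.1 hc).2.2
  refine hsum.neg_left.congr_left fun q => ?_
  rw [invSeries_add_two, ← hlead]
  have := sum_comp_length_lt (by omega) (T q)
  simp only [T] at this ⊢
  rw [this]
  abel

end Reduction

variable {Y : Type*} [NormedAddCommGroup Y] [NormedSpace ℝ Y]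

/-- The formal series `𝒦₁ ∘ K`. -/
noncomputable def compSeries (K : (j : ℕ) → ContinuousMultilinearMap ℝ (fun _ : Fin j => X) Y)
    (𝒦₁ : Y →L[ℝ] X) : FormalMultilinearSeries ℝ X X :=
  fun n => 𝒦₁.compContinuousMultilinearMap (K n)

theorem invBorn_eq_invSeries (K : (j : ℕ) → ContinuousMultilinearMap ℝ (fun _ : Fin j => X) Y)
    (𝒦₁ : Y →L[ℝ] X) (n : ℕ) (φ : Fin n → Y) :
    invBorn K 𝒦₁ n φ = invSeries (compSeries K 𝒦₁) n fun i => 𝒦₁ (φ i) := by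
  induction n using Nat.strong_induction_on with
  | _ n ih =>
    match n with
    | 0 => simp [invBorn, invSeries]
    | 1 => simp [invBorn, invSeries]
    | n + 2 =>
      rw [invBorn, invSeries, neg_apply, _root_.sum_apply]
      refine congrArg Neg.neg (sum_congr rfl fun c _ => ?_)
      rw [ih _ (mem_filter.mp c.2).2]
      rfl

end InverseBorn

open Asymptotics Finset InverseBorn in
/-- **Lemma 6.2 (first reduction of the inverse Born series).**  Assume the insertion
estimate `‖K_{j+1}(ξ₁,…,ξ_j, 𝒦₁ K_n(ξ_{j+1},…,ξ_{j+n})) - K_{j+n}(ξ)‖ ≤ C₀ ε(𝒦₁) Π‖ξ_k‖`.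
Then for every `n ≥ 2` (here `n = m + 2`) and every `R > 0` there is a constant `C` such
that for all `𝒦₁` with `‖𝒦₁‖ ≤ R` and all `φ₁,…,φ_n`:
`‖𝒦_n(φ₁,…,φ_n) + 𝒦_{n-1}(K₂(𝒦₁φ₁,𝒦₁φ₂), K₁(𝒦₁φ₃), …, K₁(𝒦₁φ_n))‖
  ≤ C ε(𝒦₁) Π ‖φ_i‖`, i.e. `𝒦_n ≃ -(𝒦_{n-1} K₂ ⊗ K₁^{⊗(n-2)}) 𝒦₁^{⊗n}`. -/
theorem stmt_7 {X Y : Type*} [NormedAddCommGroup X] [NormedSpace ℝ X] [CompleteSpace X]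
    [NormedAddCommGroup Y] [NormedSpace ℝ Y] [CompleteSpace Y]
    (K : (j : ℕ) → ContinuousMultilinearMap ℝ (fun _ : Fin j => X) Y)
    (hins : ∀ j n : ℕ, 1 ≤ j → 1 ≤ n → ∃ C₀ : ℝ, 0 ≤ C₀ ∧
      ∀ (𝒦₁ : Y →L[ℝ] X) (ξ : Fin (j + n) → X),
        ‖K (j + 1) (Fin.snoc (fun i : Fin j => ξ (Fin.castAdd n i))
              (𝒦₁ (K n (fun i : Fin n => ξ (Fin.natAdd j i)))))
            - K (j + n) ξ‖ ≤ C₀ * epsIBS K 𝒦₁ * ∏ k : Fin (j + n), ‖ξ k‖) :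
    ∀ (m : ℕ) (R : ℝ), 0 < R → ∃ C : ℝ,
      ∀ 𝒦₁ : Y →L[ℝ] X, ‖𝒦₁‖ ≤ R →
        ∀ φ : Fin (m + 2) → Y,
          ‖invBorn K 𝒦₁ (m + 2) φ +
              invBorn K 𝒦₁ (m + 1)
                (Fin.cons (K 2 (fun l : Fin 2 => 𝒦₁ (φ (Fin.castLE (by omega) l))))
                  (fun i : Fin m => K 1 (fun _ => 𝒦₁ (φ i.succ.succ))))‖
            ≤ C * epsIBS K 𝒦₁ * ∏ i : Fin (m + 2), ‖φ i‖ := by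
  intro m R hR
  let ι := {𝒦₁ : Y →L[ℝ] X // ‖𝒦₁‖ ≤ R}
  let P : ι → FormalMultilinearSeries ℝ X X := fun i => compSeries K i.1
  let ε : ι → ℝ := fun i => epsIBS K i.1
  have hP : ∀ n, (fun i => P i n) =O[⊤] fun _ => (1 : ℝ) := by
    refine fun n => isBigO_top.2 ⟨R * ‖K n‖, fun i => ?_⟩
    rw [norm_one, mul_one]
    exact (i.1.norm_compContinuousMultilinearMap_le (K n)).trans (by gcongr; exact i.2)
  have hε : ε =O[⊤] fun _ => (1 : ℝ) := by
    let L := continuousMultilinearCurryFin1 ℝ X Y (K 1)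
    refine isBigO_top.2 ⟨R * ‖L‖ + 1, fun i => ?_⟩
    rw [norm_one, mul_one, show ‖ε i‖ = ε i from Real.norm_of_nonneg (norm_nonneg _)]
    refine (norm_sub_le _ _).trans (add_le_add ?_ ContinuousLinearMap.norm_id_le)
    exact (i.1.opNorm_comp_le L).trans (by gcongr; exact i.2)
  have hone : (fun q : ι × X => P q.1 1 (fun _ => q.2) - q.2) =O[⊤] fun q => ε q.1 * ‖q.2‖ := by
    refine .of_norm_le fun q => ?_
    refine le_trans (le_of_eq ?_) (ContinuousLinearMap.le_opNorm _ q.2)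
    congr 1
  have hins' : ∀ b, 1 ≤ b → (fun q : ι × (ℕ → X) =>
      P q.1 2 ![q.2 0, P q.1 b (fun l => q.2 (1 + l))] - P q.1 (1 + b) (fun l => q.2 l)) =O[⊤]
        fun q => ε q.1 * ∏ l ∈ range (1 + b), ‖q.2 l‖ := by
    intro b hb
    obtain ⟨C₀, -, hC⟩ := hins 1 b le_rfl hb
    refine isBigO_top.2 ⟨R * C₀, fun q => ?_⟩
    have h := hC q.1.1 (fun k => q.2 k)
    rw [Fin.prod_univ_eq_prod_range (fun k => ‖q.2 k‖)] at h
    have hε0 : 0 ≤ ε q.1 := norm_nonneg _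
    rw [Real.norm_of_nonneg (mul_nonneg hε0 (prod_nonneg fun _ _ => norm_nonneg _))]
    simp only [P, compSeries, ContinuousLinearMap.compContinuousMultilinearMap_coe,
      Function.comp_apply]
    rw [← map_sub]
    refine (q.1.1.le_opNorm _).trans ?_
    rw [mul_assoc R]
    refine mul_le_mul q.1.2 ?_ (norm_nonneg _) hR.le
    rw [← mul_assoc]
    refine le_trans (le_of_eq ?_) h
    congr 3
    funext i
    fin_cases i <;> simp [Fin.snoc]
  obtain ⟨C, hC⟩ := isBigO_top.1 (isBigO_invSeries_add_reduce hP hone hε hins' m)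
  refine ⟨|C| * R ^ (m + 2), fun 𝒦₁ h𝒦₁ φ => ?_⟩
  let ξ : ℕ → X := fun k => if h : k < m + 2 then 𝒦₁ (φ ⟨k, h⟩) else 0
  have hξ : ∀ i : Fin (m + 2), ξ i = 𝒦₁ (φ i) := fun i => by simp [ξ]
  have h := hC (⟨𝒦₁, h𝒦₁⟩, ξ)
  have hε0 : 0 ≤ epsIBS K 𝒦₁ := norm_nonneg _
  have hprod : ∏ k ∈ range (m + 2), ‖ξ k‖ ≤ R ^ (m + 2) * ∏ i, ‖φ i‖ := by
    rw [← Fin.prod_univ_eq_prod_range (fun k => ‖ξ k‖)]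
    calc ∏ i : Fin (m + 2), ‖ξ i‖ ≤ ∏ i, R * ‖φ i‖ := by
          refine prod_le_prod (fun _ _ => norm_nonneg _) fun i _ => ?_
          rw [hξ]
          exact 𝒦₁.le_of_opNorm_le h𝒦₁ _
      _ = R ^ (m + 2) * ∏ i, ‖φ i‖ := by simp [prod_mul_distrib]
  rw [invBorn_eq_invSeries, invBorn_eq_invSeries]
  calc _ = ‖invSeries (compSeries K 𝒦₁) (m + 2) (fun i => ξ i) +
        invSeries (compSeries K 𝒦₁) (m + 1)
          (fun i => blockEval (compSeries K 𝒦₁) (mergeSeq fun _ => 1) ξ i)‖ := by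
        congr 3
        · funext i
          rw [hξ]
        · funext i
          refine Fin.cases ?_ (fun i => ?_) i
          · simp only [Fin.cons_zero]
            refine congrArg 𝒦₁ (congrArg (K 2) (funext fun l => ?_))
            rw [← hξ]
            simp
          · simp only [Fin.cons_succ]
            rw [Fin.val_succ, blockEval_mergeSeq_succ, blockEval_one]
            refine congrArg 𝒦₁ (congrArg (K 1) (funext fun l => ?_))
            rw [← hξ]
            simp
    _ ≤ |C| * (epsIBS K 𝒦₁ * (R ^ (m + 2) * ∏ i, ‖φ i‖)) := by
        refine h.trans (mul_le_mul (le_abs_self C) ?_ (norm_nonneg _) (abs_nonneg C))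
        rw [Real.norm_of_nonneg (mul_nonneg hε0 (prod_nonneg fun _ _ => norm_nonneg _))]
        exact mul_le_mul_of_nonneg_left hprod hε0
    _ = _ := by ring
end

section
/- Let X and Y be real Banach spaces. For each j ≥ 1 let K_j : X^j → Y be a continuous multilinear map. For a bounded linear operator 𝒦₁ : Y → X write ε(𝒦₁) := ‖𝒦₁∘K₁ − I‖ (operator norm on X), and define the inverse Born series operators 𝒦_j = 𝒦_j(𝒦₁) : Y^j → X recursively by 𝒦₁(φ) = 𝒦₁φ and, for j ≥ 2, 𝒦_j(φ₁,…,φ_j) = −Σ_{m=1}^{j−1} Σ_{(i₁,…,i_m)} 𝒦_m( K_{i₁}(𝒦₁φ₁,…,𝒦₁φ_{i₁}), …, K_{i_m}(…,𝒦₁φ_j) ), the inner sum over all compositions (i₁,…,i_m) of j into m positive parts. Assume the insertion estimate: for every j ≥ 1 and n ≥ 1 there exists C₀(j,n) ≥ 0 such that for every bounded linear 𝒦₁ : Y → X and all ξ₁,…,ξ_{j+n} ∈ X, ‖K_{j+1}(ξ₁,…,ξ_j, 𝒦₁(K_n(ξ_{j+1},…,ξ_{j+n}))) − K_{j+n}(ξ₁,…,ξ_{j+n})‖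 ≤ C₀(j,n)·ε(𝒦₁)·Π_k ‖ξ_k‖. Then for every j ≥ 2 and every R > 0 there exists a constant C such that for every bounded linear 𝒦₁ with ‖𝒦₁‖ ≤ R and all φ₁,…,φ_j ∈ Y: ‖𝒦_j(φ₁,…,φ_j) + 𝒦₁( K₂( 𝒦_{j−1}(φ₁,…,φ_{j−1}), 𝒦₁φ_j ) )‖ ≤ C·ε(𝒦₁)·Π_{i=1}^j ‖φ_i‖. -/
open Asymptotics Filter

namespace Composition

/-- Add a final block of size `n` to a composition of `k`, giving a composition of `N = k + n`. -/
def snoc {k n N : ℕ} (c : Composition k) (hn : 0 < n) (h : k + n = N) : Composition N :=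
  (c.append (single n hn)).cast h

theorem snoc_blocks {k n N : ℕ} (c : Composition k) (hn : 0 < n) (h : k + n = N) :
    (c.snoc hn h).blocks = c.blocks ++ [n] := by
  simp [snoc]

theorem snoc_length {k n N : ℕ} (c : Composition k) (hn : 0 < n) (h : k + n = N) :
    (c.snoc hn h).length = c.length + 1 := by
  simp [length, snoc_blocks]

theorem sum_eq_sum_snoc {M : Type*} [AddCommMonoid M] (N : ℕ) (g : Composition (N + 1) → M) :
    ∑ c, g c = ∑ k : Fin (N + 1), ∑ c : Composition k,
      g (c.snoc (Nat.sub_pos_of_lt k.2) (Nat.add_sub_cancel' k.2.le)) := by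
  rw [← Fintype.sum_sigma']
  symm
  refine Function.Bijective.sum_comp (g := g)
    (e := fun s : (Σ k : Fin (N + 1), Composition k) =>
      s.2.snoc (Nat.sub_pos_of_lt s.1.2) (Nat.add_sub_cancel' s.1.2.le)) ⟨?_, ?_⟩
  · rintro ⟨k, c⟩ ⟨k', c'⟩ h
    have hb := congrArg Composition.blocks h
    simp only [snoc_blocks] at hb
    obtain ⟨h1, -⟩ := List.append_inj' hb rfl
    have hk : k = k' := by
      ext
      rw [← c.blocks_sum, ← c'.blocks_sum, h1]
    subst hk
    rw [Composition.ext h1]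
  · intro c
    have hne : c.blocks ≠ [] := by simp
    have hsplit := List.dropLast_append_getLast hne
    have hsum := c.blocks_sum
    have hpos := c.blocks_pos (List.getLast_mem hne)
    rw [← hsplit, List.sum_append, List.sum_singleton] at hsum
    refine ⟨⟨⟨c.blocks.dropLast.sum, by omega⟩,
      ⟨c.blocks.dropLast, fun hi => c.blocks_pos (List.mem_of_mem_dropLast hi), rfl⟩⟩, ?_⟩
    ext1
    rw [snoc_blocks]
    conv_rhs => rw [← hsplit]
    simp only
    congr 2
    omega

end Composition

namespace FormalMultilinearSeries

variable {X : Type*} [NormedAddCommGroup X] [NormedSpace ℝ X]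

/-- The series obtained from `p` by the recursion defining the formal left inverse, under the
pretence that the linear part of `p` is the identity. -/
noncomputable def pseudoInv (p : FormalMultilinearSeries ℝ X X) : FormalMultilinearSeries ℝ X X
  | 0 => 0
  | 1 => (continuousMultilinearCurryFin1 ℝ X X).symm (ContinuousLinearMap.id ℝ X)
  | n + 2 =>
    -∑ c : { c : Composition (n + 2) // c.length < n + 2 },
      (pseudoInv p (c : Composition (n + 2)).length).compAlongComposition p c

variable (p : FormalMultilinearSeries ℝ X X)

theorem pseudoInv_one_apply (v : Fin 1 → X) : p.pseudoInv 1 v = v 0 := by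
  rw [pseudoInv]; rfl

theorem pseudoInv_add_two_apply (n : ℕ) (v : Fin (n + 2) → X) :
    p.pseudoInv (n + 2) v = -∑ c : Composition (n + 2) with c.length < n + 2,
      p.pseudoInv c.length (p.applyComposition c v) := by
  rw [pseudoInv]
  simp only [_root_.neg_apply, neg_inj, _root_.sum_apply]
  exact (Finset.sum_subtype (p := fun c : Composition (n + 2) => c.length < n + 2) _ (by simp)
    (fun c : Composition (n + 2) => p.pseudoInv c.length (p.applyComposition c v))).symm

theorem sum_pseudoInv_applyComposition (n : ℕ) (v : Fin (n + 2) → X) :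
    ∑ c : Composition (n + 2), p.pseudoInv c.length (p.applyComposition c v) =
      p.pseudoInv (n + 2) (fun i => p 1 fun _ => v i) - p.pseudoInv (n + 2) v := by
  rw [pseudoInv_add_two_apply p n v, sub_neg_eq_add,
    add_comm (p.pseudoInv (n + 2) _),
    ← Finset.sum_filter_add_sum_filter_not _ (fun c : Composition (n + 2) => c.length < n + 2)]
  congr 1
  have : (Finset.univ.filter fun c : Composition (n + 2) => ¬ c.length < n + 2) =
      {Composition.ones (n + 2)} := by
    ext c
    simp [Composition.eq_ones_iff_le_length]
  rw [this, Finset.sum_singleton, applyComposition_ones]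
  exact p.pseudoInv.congr (Composition.ones_length _) fun j hj1 hj2 => rfl

theorem sum_pseudoInv_applyComposition_one (v : Fin 1 → X) :
    ∑ c : Composition 1, p.pseudoInv c.length (p.applyComposition c v) = p 1 v := by
  have : (Finset.univ : Finset (Composition 1)) = {Composition.ones 1} := by
    ext c
    simp only [Finset.mem_univ, Finset.mem_singleton, true_iff, Composition.eq_ones_iff_le_length]
    exact c.length_pos_iff.2 Nat.one_pos
  rw [this, Finset.sum_singleton, applyComposition_ones,
    p.pseudoInv.congr (Composition.ones_length 1) (w := fun _ => p 1 v), pseudoInv_one_apply]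
  intro i _ _
  exact congrArg (p 1) (funext fun j => congrArg v (Subsingleton.elim _ _))

theorem apply_applyComposition_snoc (f : FormalMultilinearSeries ℝ X X) {k n N : ℕ}
    (c : Composition k) (hn : 0 < n) (h : k + n = N) (v : Fin N → X) :
    f (c.snoc hn h).length (p.applyComposition (c.snoc hn h) v) =
      f (c.length + 1) (Fin.snoc
        (p.applyComposition c fun i => v (Fin.cast h (Fin.castAdd n i)))
        (p n fun i => v (Fin.cast h (Fin.natAdd k i)))) := by
  refine f.congr (c.snoc_length hn h) fun i hi1 hi2 => ?_
  rcases Nat.lt_succ_iff_lt_or_eq.1 hi2 with hi | hi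
  · have : (⟨i, hi2⟩ : Fin (c.length + 1)) = Fin.castSucc ⟨i, hi⟩ := rfl
    rw [this, Fin.snoc_castSucc]
    refine p.congr ?_ fun j hj1 hj2 => ?_
    · simp [Composition.blocksFun, Composition.snoc_blocks, hi]
    · simp only [Function.comp_apply]
      congr 1
      ext
      simp [Composition.sizeUpTo, Composition.snoc_blocks, List.take_append_of_le_length,
        hi.le]
  · have : (⟨i, hi2⟩ : Fin (c.length + 1)) = Fin.last _ := Fin.ext hi
    rw [this, Fin.snoc_last]
    subst hi
    refine p.congr ?_ fun j hj1 hj2 => ?_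
    · simp [Composition.blocksFun, Composition.snoc_blocks]
    · simp only [Function.comp_apply]
      congr 1
      ext
      simp [Composition.sizeUpTo, Composition.snoc_blocks]

section Asymptotics

variable {ι : Type*} {l : Filter ι}

theorem isBigO_apply {n : ℕ} {f : ι → X [×n]→L[ℝ] X} (hf : f =O[l] (1 : ι → ℝ))
    (y : ι → Fin n → X) : (fun q => f q (y q)) =O[l] fun q => ∏ i, ‖y q i‖ := by
  have h1 : (fun q => f q (y q)) =O[l] fun q => ‖f q‖ * ∏ i, ‖y q i‖ :=
    IsBigO.of_norm_le fun q => (f q).le_opNorm _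
  refine h1.trans ?_
  simpa using hf.norm_left.mul (isBigO_refl (fun q => ∏ i, ‖y q i‖) l)

variable {P : ι → FormalMultilinearSeries ℝ X X} {ε : ι → ℝ}

theorem isBigO_pseudoInv (hP : ∀ n, (fun q => P q n) =O[l] (1 : ι → ℝ)) (n : ℕ) :
    (fun q => (P q).pseudoInv n) =O[l] (1 : ι → ℝ) := by
  induction n using Nat.strong_induction_on with | _ n ih
  match n with
  | 0 => simpa [pseudoInv] using isBigO_zero (E' := X [×0]→L[ℝ] X) (1 : ι → ℝ) l
  | 1 =>
    simp only [pseudoInv]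
    exact isBigO_const_const _ one_ne_zero l
  | n + 2 =>
    simp only [pseudoInv]
    refine (IsBigO.fun_sum fun c _ => ?_).neg_left
    have h1 : (fun q => (P q).pseudoInv.compAlongComposition (P q) c.1) =O[l]
        fun q => ‖(P q).pseudoInv c.1.length‖ * ∏ i, ‖P q (c.1.blocksFun i)‖ :=
      IsBigO.of_norm_le fun q => compAlongComposition_norm _ _ _
    refine h1.trans ?_
    simpa [Pi.one_def] using (ih _ c.2).norm_left.mul
      (IsBigO.finsetProd (s := Finset.univ) fun i _ => (hP (c.1.blocksFun i)).norm_left)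

theorem isBigO_prod_applyComposition (hP : ∀ n, (fun q => P q n) =O[l] (1 : ι → ℝ)) {n : ℕ}
    (c : Composition n) (v : ι → Fin n → X) :
    (fun q => ∏ i, ‖(P q).applyComposition c (v q) i‖) =O[l] fun q => ∏ i, ‖v q i‖ := by
  have h := IsBigO.finsetProd (s := Finset.univ) fun i _ =>
    (isBigO_apply (hP (c.blocksFun i)) fun q => v q ∘ c.embedding i).norm_left
  refine h.congr_right fun q => ?_
  exact c.prod_prod_apply_embedding fun i => ‖v q i‖

theorem isBigO_apply_sub_apply {n : ℕ} {f : ι → X [×n]→L[ℝ] X} (hf : f =O[l] (1 : ι → ℝ))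
    (y z : ι → Fin n → X) (hz : ∀ i, (fun q => z q i) =O[l] fun q => y q i)
    (hyz : ∀ i, (fun q => z q i - y q i) =O[l] fun q => ε q * ‖y q i‖) :
    (fun q => f q (z q) - f q (y q)) =O[l] fun q => ε q * ∏ i, ‖y q i‖ := by
  have h1 : (fun q => f q (z q) - f q (y q)) =O[l] fun q => ‖f q‖ *
      ∑ i, ∏ j, if j = i then ‖z q i - y q i‖ else max ‖z q j‖ ‖y q j‖ :=
    IsBigO.of_norm_le fun q => (f q).norm_image_sub_le' _ _
  refine h1.trans ?_
  have h2 : (fun q => ∑ i, ∏ j, if j = i then ‖z q i - y q i‖ else max ‖z q j‖ ‖y q j‖) =O[l]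
      fun q => ε q * ∏ i, ‖y q i‖ := by
    refine IsBigO.fun_sum fun i _ => ?_
    have h3 : (fun q => ∏ j, if j = i then ‖z q i - y q i‖ else max ‖z q j‖ ‖y q j‖) =O[l]
        fun q => ∏ j, if j = i then ε q * ‖y q i‖ else ‖y q j‖ := by
      refine IsBigO.finsetProd fun j _ => ?_
      by_cases hj : j = i
      · simpa [hj] using (hyz i).norm_left
      · simp only [hj, if_false]
        have h4 : (fun q => max ‖z q j‖ ‖y q j‖) =O[l] fun q => ‖z q j‖ + ‖y q j‖ :=
          IsBigO.of_norm_le fun q => by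
            rw [Real.norm_of_nonneg (by positivity)]
            exact max_le_add_of_nonneg (norm_nonneg _) (norm_nonneg _)
        exact h4.trans ((hz j).norm_norm.add (isBigO_refl _ _))
    refine h3.congr_right fun q => ?_
    rw [← Finset.mul_prod_erase _ _ (Finset.mem_univ i),
      ← Finset.mul_prod_erase _ (fun i => ‖y q i‖) (Finset.mem_univ i), if_pos rfl, mul_assoc]
    congr 2
    exact Finset.prod_congr rfl fun j hj => if_neg (Finset.ne_of_mem_erase hj)
  simpa using hf.norm_left.mul h2

theorem isBigO_apply_cons {n : ℕ} (hP : ∀ n, (fun q => P q n) =O[l] (1 : ι → ℝ)) {a : ι → X}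
    {g : ι → ℝ} (ha : a =O[l] g) (z : ι → Fin n → X) :
    (fun q => P q (n + 1) (Fin.cons (a q) (z q))) =O[l] fun q => g q * ∏ i, ‖z q i‖ := by
  refine (isBigO_apply (hP (n + 1)) _).trans ?_
  simp only [Fin.prod_univ_succ, Fin.cons_zero, Fin.cons_succ]
  exact ha.norm_left.mul (isBigO_refl _ _)

/-- A family of formal multilinear series which is bounded along `l`, whose linear part is the
identity up to `ε`, and for which inserting the `n`-th term in the last slot of the second one
gives the `n + 1`-st term up to `ε`. -/
structure ApproxInsertion (P : ι → FormalMultilinearSeries ℝ X X) (l : Filter ι) (ε : ι → ℝ) :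
    Prop where
  bounded : ∀ n, (fun q => P q n) =O[l] (1 : ι → ℝ)
  linear : ∀ x : ι → X, (fun q => P q 1 (fun _ => x q) - x q) =O[l] fun q => ε q * ‖x q‖
  insertion : ∀ (n : ℕ), 0 < n → ∀ (b : ι → X) (z : ι → Fin n → X),
    (fun q => P q 2 ![b q, P q n (z q)] - P q (n + 1) (Fin.cons (b q) (z q))) =O[l]
      fun q => ε q * (‖b q‖ * ∏ i, ‖z q i‖)

namespace ApproxInsertion

theorem sum_pseudoInv (hP : ApproxInsertion P l ε) (n : ℕ) (v : ι → Fin (n + 2) → X) :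
    (fun q => ∑ c : Composition (n + 2),
      (P q).pseudoInv c.length ((P q).applyComposition c (v q))) =O[l]
      fun q => ε q * ∏ i, ‖v q i‖ := by
  simp only [sum_pseudoInv_applyComposition]
  refine isBigO_apply_sub_apply (isBigO_pseudoInv hP.bounded _) _ _ (fun i => ?_)
    fun i => hP.linear _
  simpa using (isBigO_apply (hP.bounded 1) fun q _ => v q i)

/-- Approximate reduction of `pseudoInv` in degree `n + 2`. -/
def Reduces (P : ι → FormalMultilinearSeries ℝ X X) (l : Filter ι) (ε : ι → ℝ) (n : ℕ) : Prop :=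
  ∀ x : ι → Fin (n + 2) → X, (fun q => (P q).pseudoInv (n + 2) (x q) +
    P q 2 ![(P q).pseudoInv (n + 1) (Fin.init (x q)), x q (Fin.last (n + 1))]) =O[l]
      fun q => ε q * ∏ i, ‖x q i‖

theorem pseudoInv_snoc (hP : ApproxInsertion P l ε) {k n N : ℕ} (hk : 0 < k) (hn : 0 < n)
    (h : k + n = N) (c : Composition k) (ih : Reduces P l ε (c.length - 1))
    (x : ι → Fin N → X) :
    (fun q => (P q).pseudoInv (c.snoc hn h).length ((P q).applyComposition (c.snoc hn h) (x q)) +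
      P q (n + 1) (Fin.cons ((P q).pseudoInv c.length
        ((P q).applyComposition c fun i => x q (Fin.cast h (Fin.castAdd n i))))
        fun i => x q (Fin.cast h (Fin.natAdd k i)))) =O[l]
      fun q => ε q * ∏ i, ‖x q i‖ := by
  subst h
  simp only [apply_applyComposition_snoc, Fin.cast_eq_self]
  have hlen : 0 < c.length := c.length_pos_iff.2 hk
  generalize hy : (fun q => (P q).applyComposition c fun i => x q (Fin.castAdd n i)) = y
  have hyq : ∀ q, ((P q).applyComposition c fun i => x q (Fin.castAdd n i)) = y q :=
    fun q => congrFun hy q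
  have hybd : (fun q => ∏ i, ‖y q i‖) =O[l] fun q => ∏ i, ‖x q (Fin.castAdd n i)‖ :=
    hy ▸ isBigO_prod_applyComposition hP.bounded c fun q i => x q (Fin.castAdd n i)
  simp only [hyq]
  clear hy hyq
  generalize c.length = r at *
  obtain ⟨r, rfl⟩ := Nat.exists_eq_add_one_of_ne_zero hlen.ne'
  rw [Nat.add_sub_cancel] at ih
  set w : ι → X := fun q => P q n fun i => x q (Fin.natAdd k i) with hw
  have hwbd : w =O[l] fun q => ∏ i, ‖x q (Fin.natAdd k i)‖ := isBigO_apply (hP.bounded n) _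
  set b : ι → X := fun q => (P q).pseudoInv (r + 1) (y q) with hb
  have hbbd : b =O[l] fun q => ∏ i, ‖x q (Fin.castAdd n i)‖ :=
    (isBigO_apply (isBigO_pseudoInv hP.bounded _) y).trans hybd
  have h1 := ih fun q => Fin.snoc (y q) (w q)
  simp only [Fin.init_snoc, Fin.snoc_last] at h1
  have h1' : (fun q => (P q).pseudoInv (r + 2) (Fin.snoc (y q) (w q)) +
      P q 2 ![b q, w q]) =O[l] fun q => ε q * ∏ i, ‖x q i‖ := by
    refine h1.trans ?_
    have hprod : ∀ q, ∏ i, ‖(Fin.snoc (y q) (w q) : Fin (r + 2) → X) i‖ =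
        (∏ i, ‖y q i‖) * ‖w q‖ := fun q => by
      rw [Fin.prod_univ_castSucc]
      simp only [Fin.snoc_castSucc, Fin.snoc_last]
    simp only [Fin.prod_univ_add (fun i => ‖x _ i‖), hprod]
    exact (isBigO_refl _ _).mul (hybd.mul hwbd.norm_left)
  have h2 : (fun q => P q 2 ![b q, w q] - P q (n + 1) (Fin.cons (b q)
      fun i => x q (Fin.natAdd k i))) =O[l] fun q => ε q * ∏ i, ‖x q i‖ := by
    refine (hP.insertion n hn b _).trans ?_
    simp only [Fin.prod_univ_add (fun i => ‖x _ i‖)]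
    exact (isBigO_refl _ _).mul (hbbd.norm_left.mul (isBigO_refl _ _))
  refine (h1'.sub h2).congr_left fun q => ?_
  simp only [hb]
  abel

/-- The contribution to `pseudoInv` of the compositions whose last block has size `n`. -/
theorem sum_pseudoInv_snoc (hP : ApproxInsertion P l ε) {k n N : ℕ} (hk : 0 < k) (hn : 0 < n)
    (h : k + n = N) (S : Finset (Composition k))
    (ih : ∀ c ∈ S, Reduces P l ε (c.length - 1)) (x : ι → Fin N → X) :
    (fun q => (∑ c ∈ S, (P q).pseudoInv (c.snoc hn h).length
        ((P q).applyComposition (c.snoc hn h) (x q))) +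
      P q (n + 1) (Fin.cons (∑ c ∈ S, (P q).pseudoInv c.length
        ((P q).applyComposition c fun i => x q (Fin.cast h (Fin.castAdd n i))))
        fun i => x q (Fin.cast h (Fin.natAdd k i)))) =O[l]
      fun q => ε q * ∏ i, ‖x q i‖ := by
  refine (IsBigO.fun_sum fun c hc => hP.pseudoInv_snoc hk hn h c (ih c hc) x).congr_left
    fun q => ?_
  rw [Finset.sum_add_distrib]
  congr 1
  simp only [← ContinuousMultilinearMap.curryLeft_apply, map_sum, _root_.sum_apply]

end ApproxInsertion

end Asymptotics

/-- The sum, over the compositions of `N` into fewer than `N` blocks for which all blocks but the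
last one make up a composition of `k`, of the terms in the recursion for `pseudoInv`. -/
noncomputable def blockSum {N : ℕ} (v : Fin N → X) (k : ℕ) (hk : k < N) : X :=
  ∑ c : Composition k with c.length + 1 < N,
    p.pseudoInv (c.snoc (Nat.sub_pos_of_lt hk) (Nat.add_sub_cancel' hk.le)).length
      (p.applyComposition (c.snoc (Nat.sub_pos_of_lt hk) (Nat.add_sub_cancel' hk.le)) v)

theorem pseudoInv_eq_neg_sum_blockSum (N : ℕ) (v : Fin (N + 2) → X) :
    p.pseudoInv (N + 2) v = -∑ k : Fin (N + 2), p.blockSum v k k.2 := by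
  rw [pseudoInv_add_two_apply, Finset.sum_filter, Composition.sum_eq_sum_snoc]
  simp only [blockSum, Finset.sum_filter, Composition.snoc_length]

theorem blockSum_zero {N : ℕ} (hN : 1 < N) (v : Fin N → X) :
    p.blockSum v 0 (Nat.zero_lt_of_lt hN) = p N v := by
  have hc : ∀ c : Composition 0, c.length = 0 := fun c => c.length_eq_zero.2 rfl
  simp only [blockSum, hc, zero_add, hN, Finset.filter_true, apply_applyComposition_snoc]
  have huniv : (Finset.univ : Finset (Composition 0)) = {Composition.ones 0} := by
    ext c
    simp [Composition.eq_ones_iff_le_length]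
  rw [huniv, Finset.sum_singleton]
  refine (p.pseudoInv.congr (w := fun _ => p N v) (congrArg (· + 1) (hc _)) ?_).trans
    (p.pseudoInv_one_apply _)
  intro i h1 h2
  have : (⟨i, h1⟩ : Fin ((Composition.ones 0).length + 1)) = Fin.last _ :=
    Fin.ext ((Nat.lt_one_iff.1 h2).trans (hc _).symm)
  rw [this, Fin.snoc_last]
  refine p.congr (Nat.sub_zero N) fun j _ _ => ?_
  congr 1
  ext
  simp

section Asymptotics

variable {ι : Type*} {l : Filter ι} {P : ι → FormalMultilinearSeries ℝ X X} {ε : ι → ℝ}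

namespace ApproxInsertion

theorem blockSum_add (hP : ApproxInsertion P l ε) {k n N : ℕ} (hk : 0 < k) (hn : 0 < n)
    (h : k + n = N) (ih : ∀ r, r + 2 < N → Reduces P l ε r) (x : ι → Fin N → X) :
    (fun q => (P q).blockSum (x q) k (h ▸ Nat.lt_add_of_pos_right hn) +
      P q (n + 1) (Fin.cons (∑ c : Composition k with c.length + 1 < N,
        (P q).pseudoInv c.length
          ((P q).applyComposition c fun i => x q (Fin.cast h (Fin.castAdd n i))))
        fun i => x q (Fin.cast h (Fin.natAdd k i)))) =O[l]
      fun q => ε q * ∏ i, ‖x q i‖ := by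
  obtain rfl : n = N - k := by omega
  refine hP.sum_pseudoInv_snoc hk hn h _ (fun c hc => ih _ ?_) x
  have := c.length_pos_iff.2 hk
  have := (Finset.mem_filter.1 hc).2
  omega

theorem filter_length_eq_univ {k N : ℕ} (h : k + 1 < N) :
    (Finset.univ.filter fun c : Composition k => c.length + 1 < N) = Finset.univ :=
  Finset.filter_true_of_mem fun c _ => (Nat.succ_le_succ c.length_le).trans_lt h

theorem blockSum_one (hP : ApproxInsertion P l ε) {n : ℕ} (hn : 1 < n)
    (ih : ∀ r, r + 1 < n → Reduces P l ε r) (x : ι → Fin (n + 1) → X) :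
    (fun q => (P q).blockSum (x q) 1 (by omega) + P q (n + 1) (x q)) =O[l]
      fun q => ε q * ∏ i, ‖x q i‖ := by
  have h1 := hP.blockSum_add one_pos (by omega : 0 < n) (add_comm 1 n)
    (fun r hr => ih r (by omega)) x
  simp only [filter_length_eq_univ (show 1 + 1 < n + 1 by omega),
    sum_pseudoInv_applyComposition_one] at h1
  have h2 : (fun q => P q (n + 1) (Fin.cons (P q 1 fun _ => x q 0) fun i => x q i.succ) -
      P q (n + 1) (x q)) =O[l] fun q => ε q * ∏ i, ‖x q i‖ := by
    have h3 := isBigO_apply_cons hP.bounded (hP.linear fun q => x q 0) fun q i => x q i.succ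
    simp only [Fin.prod_univ_succ (fun i => ‖x _ i‖), ← mul_assoc]
    refine h3.congr_left fun q => ?_
    have := (P q (n + 1)).curryLeft.map_sub (P q 1 fun _ => x q 0) (x q 0)
    have := congrArg (fun f => f fun i => x q i.succ) this
    simp only [ContinuousMultilinearMap.curryLeft_apply, _root_.sub_apply] at this
    rw [this]
    congr 2
    exact Fin.cons_self_tail (x q)
  refine (h1.sub h2).congr_left fun q => ?_
  have e1 : (fun i : Fin 1 => x q (Fin.cast (add_comm 1 n) (Fin.castAdd n i))) =
      fun _ => x q 0 := funext fun i => congrArg (x q) (Fin.ext (by simp))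
  have e2 : (fun i : Fin n => x q (Fin.cast (add_comm 1 n) (Fin.natAdd 1 i))) =
      fun i => x q i.succ := funext fun i => congrArg (x q) (Fin.ext (by simp))
  rw [e1, e2]
  abel

theorem blockSum_middle (hP : ApproxInsertion P l ε) {k N : ℕ} (hk : k + 3 < N)
    (ih : ∀ r, r + 2 < N → Reduces P l ε r) (x : ι → Fin N → X) :
    (fun q => (P q).blockSum (x q) (k + 2) (by omega)) =O[l]
      fun q => ε q * ∏ i, ‖x q i‖ := by
  obtain ⟨n, rfl⟩ : ∃ n, N = k + 2 + n := ⟨N - (k + 2), by omega⟩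
  have h1 := hP.blockSum_add (by omega : 0 < k + 2) (by omega : 0 < n) rfl ih x
  simp only [filter_length_eq_univ (show k + 2 + 1 < k + 2 + n by omega)] at h1
  have h2 := isBigO_apply_cons hP.bounded
    (hP.sum_pseudoInv k fun q i => x q (Fin.castAdd n i)) fun q i => x q (Fin.natAdd (k + 2) i)
  have hprod : ∀ q, (ε q * ∏ i, ‖x q (Fin.castAdd n i)‖) * ∏ i, ‖x q (Fin.natAdd (k + 2) i)‖ =
      ε q * ∏ i, ‖x q i‖ := fun q => by
    rw [Fin.prod_univ_add fun i : Fin (k + 2 + n) => ‖x q i‖, mul_assoc]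
  simp only [hprod] at h2
  refine (h1.sub h2).congr_left fun q => ?_
  exact add_sub_cancel_right _ _

theorem blockSum_last (hP : ApproxInsertion P l ε) {k : ℕ}
    (ih : ∀ r, r < k + 1 → Reduces P l ε r) (x : ι → Fin (k + 3) → X) :
    (fun q => (P q).blockSum (x q) (k + 2) (by omega) -
      P q 2 ![(P q).pseudoInv (k + 2) (Fin.init (x q)), x q (Fin.last (k + 2))]) =O[l]
      fun q => ε q * ∏ i, ‖x q i‖ := by
  have h1 := hP.blockSum_add (by omega : 0 < k + 2) one_pos rfl
    (fun r hr => ih r (by omega)) x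
  refine h1.congr_left fun q => ?_
  rw [sub_eq_add_neg, ← ContinuousMultilinearMap.curryLeft_apply]
  have : (∑ c : Composition (k + 2) with c.length + 1 < k + 2 + 1, (P q).pseudoInv c.length
      ((P q).applyComposition c fun i => x q (Fin.cast rfl (Fin.castAdd 1 i)))) =
      -(P q).pseudoInv (k + 2) (Fin.init (x q)) := by
    rw [pseudoInv_add_two_apply, neg_neg]
    simp only [add_lt_add_iff_right]
    rfl
  rw [this, map_neg, _root_.neg_apply, ContinuousMultilinearMap.curryLeft_apply]
  congr 3
  ext i
  refine Fin.cases rfl (fun i => ?_) i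
  rw [Subsingleton.elim i 0]
  rfl

theorem reduces (hP : ApproxInsertion P l ε) (m : ℕ) : Reduces P l ε m := by
  induction m using Nat.strong_induction_on with | _ m ih
  intro x
  match m with
  | 0 =>
    refine (isBigO_zero _ l).congr_left fun q => ?_
    rw [pseudoInv_eq_neg_sum_blockSum, Fin.sum_univ_two]
    have h1 : (P q).blockSum (x q) 1 one_lt_two = 0 := by
      refine Finset.sum_eq_zero fun c hc => absurd (Finset.mem_filter.1 hc).2 ?_
      have := c.length_pos_iff.2 one_pos
      omega
    have h0 := (P q).blockSum_zero one_lt_two (x q)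
    simp only [Fin.val_zero, Fin.val_one, h1, h0, add_zero]
    have : ![(P q).pseudoInv (0 + 1) (Fin.init (x q)), x q (Fin.last (0 + 1))] = x q := by
      refine funext fun i => Fin.cases ((P q).pseudoInv_one_apply _) (fun i => ?_) i
      rw [Subsingleton.elim i 0]
      rfl
    rw [this]
    exact (neg_add_cancel _).symm
  | N + 1 =>
    have hmid : (fun q => ∑ i : Fin N, (P q).blockSum (x q) (i + 2) (by omega)) =O[l]
        fun q => ε q * ∏ i, ‖x q i‖ :=
      IsBigO.fun_sum fun i _ =>
        hP.blockSum_middle (by omega) (fun r hr => ih r (by omega)) x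
    have hone := hP.blockSum_one (by omega : 1 < N + 2) (fun r hr => ih r (by omega)) x
    have hlast := hP.blockSum_last (fun r hr => ih r hr) x
    refine ((hone.add hmid).add hlast).neg_left.congr_left fun q => ?_
    rw [(P q).pseudoInv_eq_neg_sum_blockSum (N + 1), Fin.sum_univ_succ, Fin.sum_univ_succ,
      Fin.sum_univ_castSucc]
    have h0 := (P q).blockSum_zero (by omega : 1 < N + 3) (x q)
    simp only [Fin.val_zero, Fin.val_succ, Fin.val_castSucc, Fin.val_last, h0, zero_add, add_assoc,
      Nat.reduceAdd]
    abel

end ApproxInsertion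

end Asymptotics

end FormalMultilinearSeries

/-- The formal multilinear series with terms `𝒦₁ ∘ K_n`. -/
def bornSeries {X Y : Type*} [NormedAddCommGroup X] [NormedSpace ℝ X]
    [NormedAddCommGroup Y] [NormedSpace ℝ Y]
    (K : (j : ℕ) → ContinuousMultilinearMap ℝ (fun _ : Fin j => X) Y)
    (𝒦₁ : Y →L[ℝ] X) : FormalMultilinearSeries ℝ X X :=
  fun n => 𝒦₁.compContinuousMultilinearMap (K n)

theorem invBorn_eq_pseudoInv {X Y : Type*} [NormedAddCommGroup X] [NormedSpace ℝ X]
    [NormedAddCommGroup Y] [NormedSpace ℝ Y]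
    (K : (j : ℕ) → ContinuousMultilinearMap ℝ (fun _ : Fin j => X) Y)
    (T : Y →L[ℝ] X) (n : ℕ) (φ : Fin n → Y) :
    invBorn K T n φ = (bornSeries K T).pseudoInv n fun i => T (φ i) := by
  induction n using Nat.strong_induction_on with | _ n ih
  match n with
  | 0 =>
    rw [invBorn, FormalMultilinearSeries.pseudoInv]
    rfl
  | 1 => rw [invBorn, FormalMultilinearSeries.pseudoInv_one_apply]
  | n + 2 =>
    rw [invBorn, FormalMultilinearSeries.pseudoInv_add_two_apply, ← Finset.sum_attach]
    refine congrArg _ (Finset.sum_congr rfl fun c _ => ?_)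
    rw [ih _ (Finset.mem_filter.1 c.2).2]
    rfl

/-- The insertion estimate for the forward operators makes the series `𝒦₁ ∘ K_n` approximately
closed under insertion, uniformly over `‖𝒦₁‖ ≤ R`. -/
theorem approxInsertion_born {X Y ι : Type*} [NormedAddCommGroup X] [NormedSpace ℝ X]
    [NormedAddCommGroup Y] [NormedSpace ℝ Y]
    (K : (j : ℕ) → ContinuousMultilinearMap ℝ (fun _ : Fin j => X) Y)
    (hins : ∀ n : ℕ, 1 ≤ n → ∃ C₀ : ℝ, 0 ≤ C₀ ∧
      ∀ (𝒦₁ : Y →L[ℝ] X) (ξ : Fin (1 + n) → X),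
        ‖K (1 + 1) (Fin.snoc (fun i : Fin 1 => ξ (Fin.castAdd n i))
              (𝒦₁ (K n (fun i : Fin n => ξ (Fin.natAdd 1 i)))))
            - K (1 + n) ξ‖ ≤ C₀ * epsIBS K 𝒦₁ * ∏ k : Fin (1 + n), ‖ξ k‖)
    (R : ℝ) (T : ι → Y →L[ℝ] X) :
    FormalMultilinearSeries.ApproxInsertion (fun q => bornSeries K (T q))
      (𝓟 {q | ‖T q‖ ≤ R}) (fun q => epsIBS K (T q)) where
  bounded n := by
    refine isBigO_principal.2 ⟨R * ‖K n‖, fun q hq => ?_⟩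
    rw [Pi.one_apply, norm_one, mul_one]
    exact ((T q).norm_compContinuousMultilinearMap_le (K n)).trans
      (mul_le_mul_of_nonneg_right hq (norm_nonneg _))
  linear x := by
    refine IsBigO.of_norm_le fun q => ?_
    exact ((T q).comp (continuousMultilinearCurryFin1 ℝ X Y (K 1)) -
      ContinuousLinearMap.id ℝ X).le_opNorm (x q)
  insertion n hn b z := by
    obtain ⟨C₀, hC₀, h⟩ := hins n hn
    refine isBigO_principal.2 ⟨R * C₀, fun q hq => ?_⟩
    have hε : 0 ≤ epsIBS K (T q) := norm_nonneg _
    have hR : 0 ≤ R := (norm_nonneg _).trans hq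
    have h1 := h (T q) (fun i => (Fin.cons (b q) (z q) : Fin (n + 1) → X)
      (Fin.cast (add_comm 1 n) i))
    have e1 : (Fin.snoc (fun i : Fin 1 => (Fin.cons (b q) (z q) : Fin (n + 1) → X)
        (Fin.cast (add_comm 1 n) (Fin.castAdd n i)))
        (T q (K n fun i : Fin n => (Fin.cons (b q) (z q) : Fin (n + 1) → X)
          (Fin.cast (add_comm 1 n) (Fin.natAdd 1 i)))) : Fin 2 → X) =
        ![b q, T q (K n (z q))] := by
      have e3 : (fun i : Fin n => (Fin.cons (b q) (z q) : Fin (n + 1) → X)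
          (Fin.cast (add_comm 1 n) (Fin.natAdd 1 i))) = z q := funext fun i => by
        rw [show Fin.cast (add_comm 1 n) (Fin.natAdd 1 i) = i.succ from Fin.ext (by simp),
          Fin.cons_succ]
      rw [e3]
      refine funext fun i => Fin.cases rfl (fun i => ?_) i
      rw [Subsingleton.elim i 0]
      rfl
    have e2 : K (1 + n) (fun i => (Fin.cons (b q) (z q) : Fin (n + 1) → X)
        (Fin.cast (add_comm 1 n) i)) = K (n + 1) (Fin.cons (b q) (z q)) :=
      FormalMultilinearSeries.congr K (add_comm 1 n) fun _ _ _ => rfl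
    have e4 : ∏ i : Fin (1 + n), ‖(Fin.cons (b q) (z q) : Fin (n + 1) → X)
        (Fin.cast (add_comm 1 n) i)‖ = ‖b q‖ * ∏ i, ‖z q i‖ := by
      refine ((finCongr (add_comm 1 n)).prod_comp
        fun i => ‖(Fin.cons (b q) (z q) : Fin (n + 1) → X) i‖).trans ?_
      rw [Fin.prod_univ_succ]
      simp only [Fin.cons_zero, Fin.cons_succ]
    rw [e1, e2, e4] at h1
    change ‖T q (K 2 ![b q, T q (K n (z q))]) - T q (K (n + 1) (Fin.cons (b q) (z q)))‖ ≤ _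
    rw [← map_sub, Real.norm_of_nonneg (by positivity)]
    calc _ ≤ ‖T q‖ * _ := (T q).le_opNorm _
      _ ≤ R * (C₀ * epsIBS K (T q) * (‖b q‖ * ∏ i, ‖z q i‖)) := by
        gcongr
        exact hq
      _ = _ := by ring

/-- **Lemma 7.1 (second, Hoskins–Schotland type, reduction of the inverse Born
series).**  Assume the insertion estimate
`‖K_{j+1}(ξ₁,…,ξ_j, 𝒦₁ K_n(ξ_{j+1},…,ξ_{j+n})) - K_{j+n}(ξ)‖ ≤ C₀ ε(𝒦₁) Π‖ξ_k‖`.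
Then for every `j ≥ 2` (here `j = m + 2`) and every `R > 0` there is a constant `C`
such that for all `𝒦₁` with `‖𝒦₁‖ ≤ R` and all `φ₁,…,φ_j`:
`‖𝒦_j(φ₁,…,φ_j) + 𝒦₁(K₂(𝒦_{j-1}(φ₁,…,φ_{j-1}), 𝒦₁φ_j))‖ ≤ C ε(𝒦₁) Π ‖φ_i‖`,
i.e. `𝒦_j ≃ -𝒦₁ K₂ (𝒦_{j-1} ⊗ 𝒦₁)`. -/
theorem stmt_8 {X Y : Type*} [NormedAddCommGroup X] [NormedSpace ℝ X] [CompleteSpace X]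
    [NormedAddCommGroup Y] [NormedSpace ℝ Y] [CompleteSpace Y]
    (K : (j : ℕ) → ContinuousMultilinearMap ℝ (fun _ : Fin j => X) Y)
    (hins : ∀ j n : ℕ, 1 ≤ j → 1 ≤ n → ∃ C₀ : ℝ, 0 ≤ C₀ ∧
      ∀ (𝒦₁ : Y →L[ℝ] X) (ξ : Fin (j + n) → X),
        ‖K (j + 1) (Fin.snoc (fun i : Fin j => ξ (Fin.castAdd n i))
              (𝒦₁ (K n (fun i : Fin n => ξ (Fin.natAdd j i)))))
            - K (j + n) ξ‖ ≤ C₀ * epsIBS K 𝒦₁ * ∏ k : Fin (j + n), ‖ξ k‖) :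
    ∀ (m : ℕ) (R : ℝ), 0 < R → ∃ C : ℝ,
      ∀ 𝒦₁ : Y →L[ℝ] X, ‖𝒦₁‖ ≤ R →
        ∀ φ : Fin (m + 2) → Y,
          ‖invBorn K 𝒦₁ (m + 2) φ +
              𝒦₁ (K 2 ![invBorn K 𝒦₁ (m + 1) (fun i : Fin (m + 1) => φ i.castSucc),
                        𝒦₁ (φ (Fin.last (m + 1)))])‖
            ≤ C * epsIBS K 𝒦₁ * ∏ i : Fin (m + 2), ‖φ i‖ := by
  intro m R hR
  have h := (approxInsertion_born K (fun n => hins 1 n le_rfl) R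
    (Prod.fst : (Y →L[ℝ] X) × (Fin (m + 2) → Y) → Y →L[ℝ] X)).reduces m
      fun q i => q.1 (q.2 i)
  obtain ⟨C, hC⟩ := isBigO_principal.1 h
  refine ⟨|C| * R ^ (m + 2), fun T hT φ => ?_⟩
  have hε : 0 ≤ epsIBS K T := norm_nonneg _
  rw [invBorn_eq_pseudoInv, invBorn_eq_pseudoInv]
  refine (hC (T, φ) hT).trans ?_
  rw [Real.norm_of_nonneg (by positivity)]
  calc _ ≤ |C| * (epsIBS K T * ∏ i, R * ‖φ i‖) := by
        gcongr with i
        · exact le_abs_self C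
        · exact T.le_of_opNorm_le hT _
    _ = _ := by
        rw [Finset.prod_mul_distrib, Finset.prod_const, Finset.card_univ, Fintype.card_fin]
        ring
end

section
/- Let X and Y be real Banach spaces. For each j ≥ 1 let K_j : X^j → Y be a continuous multilinear map, and let 𝒦₁ : Y → X be a bounded linear operator. Assume (i) 𝒦₁∘K₁ = I on X, and (ii) the exact insertion identity: for all j ≥ 1, n ≥ 1 and all ξ₁,…,ξ_{j+n} ∈ X, K_{j+1}(ξ₁,…,ξ_j, 𝒦₁(K_n(ξ_{j+1},…,ξ_{j+n}))) = K_{j+n}(ξ₁,…,ξ_{j+n}). Define the inverse Born series operators 𝒦_j : Y^j → X by 𝒦₁(φ) = 𝒦₁φ and, for j ≥ 2, 𝒦_j(φ₁,…,φ_j) = −Σ_{m=1}^{j−1} Σ_{(i₁,…,i_m)} 𝒦_m(K_{i₁}(𝒦₁φ₁,…,𝒦₁φ_{i₁}), …, K_{i_m}(…,𝒦₁φ_j)) (inner sum over compositions of j into m positive parts), and the reduced operators K̃₁ = 𝒦₁, K̃₂ = 𝒦₂, K̃_j(φ₁,…,φ_j) = −K̃_{j−1}(K₂(𝒦₁φ₁,𝒦₁φ₂),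 K₁(𝒦₁φ₃), …, K₁(𝒦₁φ_j)) for j ≥ 3. Then 𝒦_n = K̃_n for every n ≥ 1, and consequently the fast iterates η̃⁽⁰⁾ = 0, η̃⁽¹⁾ = 𝒦₁φ, η̃⁽ⁿ⁺¹⁾ = η̃⁽ⁿ⁾ − 𝒦₁(K₂(η̃⁽ⁿ⁾ − η̃⁽ⁿ⁻¹⁾, η̃⁽¹⁾)) satisfy η̃⁽ⁿ⁾ = Σ_{j=1}^n 𝒦_j(φ,…,φ) for all n ≥ 1 and φ ∈ Y. -/
/-- The reduced inverse Born series operators: `K̃₁ = 𝒦₁`, `K̃₂ = 𝒦₂`, and for `j ≥ 3`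
`K̃_j(φ₁,…,φ_j) = -K̃_{j-1}(K₂(𝒦₁φ₁,𝒦₁φ₂), K₁(𝒦₁φ₃), …, K₁(𝒦₁φ_j))`
(index shift: `redKM n = K̃_{n+1}`). -/
noncomputable def redKM {X Y : Type*} [NormedAddCommGroup X] [NormedSpace ℝ X]
    [NormedAddCommGroup Y] [NormedSpace ℝ Y]
    (K : (j : ℕ) → ContinuousMultilinearMap ℝ (fun _ : Fin j => X) Y)
    (𝒦₁ : Y →L[ℝ] X) : (n : ℕ) → (Fin (n + 1) → Y) → X
  | 0, φ => 𝒦₁ (φ 0)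
  | 1, φ => invBorn K 𝒦₁ 2 φ
  | n + 2, φ => -redKM K 𝒦₁ (n + 1)
      (Fin.cons (K 2 ![𝒦₁ (φ 0), 𝒦₁ (φ 1)])
        (fun i : Fin (n + 1) => K 1 ![𝒦₁ (φ i.succ.succ)]))

/-- The fast iterative scheme: `η̃⁽⁰⁾ = 0`, `η̃⁽¹⁾ = 𝒦₁φ`, and
`η̃⁽ⁿ⁺¹⁾ = η̃⁽ⁿ⁾ - 𝒦₁(K₂(η̃⁽ⁿ⁾ - η̃⁽ⁿ⁻¹⁾, η̃⁽¹⁾))` for `n ≥ 1`. -/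
noncomputable def fastIterM {X Y : Type*} [NormedAddCommGroup X] [NormedSpace ℝ X]
    [NormedAddCommGroup Y] [NormedSpace ℝ Y]
    (K : (j : ℕ) → ContinuousMultilinearMap ℝ (fun _ : Fin j => X) Y)
    (𝒦₁ : Y →L[ℝ] X) (φ : Y) : ℕ → X
  | 0 => 0
  | 1 => 𝒦₁ φ
  | n + 2 => fastIterM K 𝒦₁ φ (n + 1) -
      𝒦₁ (K 2 ![fastIterM K 𝒦₁ φ (n + 1) - fastIterM K 𝒦₁ φ n, 𝒦₁ φ])

/-- The signed left-nested product `(-1)ⁿ⁻¹ ((x₁ ⋆ x₂) ⋆ ⋯) ⋆ xₙ` of a list. -/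
def leftNest {X : Type*} [AddCommGroup X] (s : X → X → X) : List X → X
  | [] => 0
  | x :: l => l.foldl (fun a y => -s a y) x

/-- The right-nested product `x₁ ⋆ (x₂ ⋆ (⋯ ⋆ xₙ))` of a list. -/
def rightNest {X : Type*} [Zero X] (s : X → X → X) : List X → X
  | [] => 0
  | [x] => x
  | x :: y :: l => s x (rightNest s (y :: l))

lemma rightNest_cons {X : Type*} [Zero X] (s : X → X → X) (x : X) {l : List X} (hl : l ≠ []) :
    rightNest s (x :: l) = s x (rightNest s l) := by
  cases l with
  | nil => exact absurd rfl hl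
  | cons y l => rfl

lemma leftNest_concat {X : Type*} [AddCommGroup X] (s : X → X → X) {l : List X} (hl : l ≠ [])
    (x : X) : leftNest s (l ++ [x]) = -s (leftNest s l) x := by
  cases l with
  | nil => exact absurd rfl hl
  | cons y l => simp [leftNest]

lemma leftNest_neg_cons {X : Type*} [AddCommGroup X] {s : X → X → X}
    (hs : ∀ x y, s (-x) y = -s x y) (x : X) (l : List X) :
    leftNest s (-x :: l) = -leftNest s (x :: l) := by
  induction l generalizing x with
  | nil => rfl
  | cons y l ih => exact (congrArg (fun z => leftNest s (-z :: l)) (hs x y)).trans (ih _)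

/-- The involution on blocks which merges a leading block of size `1` with its successor, and
splits a unit off a larger leading block. -/
def toggleHead : List ℕ → List ℕ
  | 1 :: b :: t => (b + 1) :: t
  | (b + 2) :: t => 1 :: (b + 1) :: t
  | l => l

lemma Composition.blocks_eq_cons {n : ℕ} (c : Composition (n + 2)) :
    (∃ b t, c.blocks = 1 :: (b + 1) :: t) ∨ ∃ b t, c.blocks = (b + 2) :: t := by
  have h₁ := c.blocks_sum
  have h₂ : ∀ i ∈ c.blocks, 0 < i := fun i hi => c.blocks_pos hi
  generalize c.blocks = l at h₁ h₂
  match l with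
  | [] => simp at h₁
  | 0 :: t => simp at h₂
  | [1] => simp at h₁
  | 1 :: 0 :: t => simp at h₂
  | 1 :: (b + 1) :: t => exact Or.inl ⟨b, t, rfl⟩
  | (b + 2) :: t => exact Or.inr ⟨b, t, rfl⟩

/-- The involution `toggleHead` on compositions. -/
def Composition.toggle {n : ℕ} (c : Composition (n + 2)) : Composition (n + 2) where
  blocks := toggleHead c.blocks
  blocks_pos := by
    have h : ∀ i ∈ c.blocks, 0 < i := fun i hi => c.blocks_pos hi
    intro i
    rcases c.blocks_eq_cons with ⟨b, t, e⟩ | ⟨b, t, e⟩ <;>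
    · rw [e] at h ⊢
      simp only [toggleHead, List.mem_cons]
      simp only [List.mem_cons] at h
      grind
  blocks_sum := by
    have h := c.blocks_sum
    rcases c.blocks_eq_cons with ⟨b, t, e⟩ | ⟨b, t, e⟩ <;>
    · rw [e] at h ⊢
      simp only [toggleHead, List.sum_cons] at h ⊢
      omega

lemma leftNest_split_add {X : Type*} [AddCommGroup X] {s : X → X → X}
    (hs : ∀ x y, s (-x) y = -s x y) {l : List X} (hl : 2 ≤ l.length) (b : ℕ) (t : List ℕ) :
    leftNest s ((l.splitWrtCompositionAux (1 :: (b + 1) :: t)).map (rightNest s)) +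
      leftNest s ((l.splitWrtCompositionAux ((b + 2) :: t)).map (rightNest s)) = 0 := by
  match l with
  | [] => simp at hl
  | [x] => simp at hl
  | x :: y :: l =>
    have h : leftNest s (x :: rightNest s (y :: l.take b) ::
          ((l.drop b).splitWrtCompositionAux t).map (rightNest s)) =
        leftNest s (-s x (rightNest s (y :: l.take b)) ::
          ((l.drop b).splitWrtCompositionAux t).map (rightNest s)) := rfl
    rw [leftNest_neg_cons hs] at h
    simp [List.splitWrtCompositionAux_cons, rightNest, h]

lemma sum_leftNest_split {X : Type*} [AddCommGroup X] {s : X → X → X}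
    (hs : ∀ x y, s (-x) y = -s x y) {n : ℕ} {l : List X} (hl : l.length = n + 2) :
    ∑ c : Composition (n + 2), leftNest s ((l.splitWrtComposition c).map (rightNest s)) = 0 := by
  refine Finset.sum_involution (fun c _ => c.toggle) ?_ ?_ (fun _ _ => Finset.mem_univ _) ?_
  · intro c _
    rcases c.blocks_eq_cons with ⟨b, t, e⟩ | ⟨b, t, e⟩
    · simpa only [List.splitWrtComposition, Composition.toggle, e, toggleHead] using
        leftNest_split_add hs (by omega) b t
    · rw [add_comm]
      simpa only [List.splitWrtComposition, Composition.toggle, e, toggleHead] using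
        leftNest_split_add hs (by omega) b t
  · intro c _ _ h
    have h := congrArg (fun c => c.blocks.length) h
    rcases c.blocks_eq_cons with ⟨b, t, e⟩ | ⟨b, t, e⟩ <;>
      simp [Composition.toggle, e, toggleHead] at h
  · intro c _
    ext1
    rcases c.blocks_eq_cons with ⟨b, t, e⟩ | ⟨b, t, e⟩ <;>
      simp [Composition.toggle, e, toggleHead]

lemma splitWrtCompositionAux_replicate_one {α : Type*} (l : List α) :
    l.splitWrtCompositionAux (List.replicate l.length 1) = l.map fun x => [x] := by
  induction l with
  | nil => rfl
  | cons x l ih => simp [List.replicate_succ, List.splitWrtCompositionAux_cons, ih]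

lemma leftNest_split_ones {X : Type*} [AddCommGroup X] (s : X → X → X) {n : ℕ} {l : List X}
    (hl : l.length = n) :
    leftNest s ((l.splitWrtComposition (Composition.ones n)).map (rightNest s)) =
      leftNest s l := by
  subst hl
  rw [List.splitWrtComposition, Composition.ones_blocks, splitWrtCompositionAux_replicate_one]
  simp [Function.comp_def, rightNest]

lemma sum_leftNest_split_of_length_lt {X : Type*} [AddCommGroup X] {s : X → X → X}
    (hs : ∀ x y, s (-x) y = -s x y) {n : ℕ} {l : List X} (hl : l.length = n + 2) :
    ∑ c : Composition (n + 2) with c.length < n + 2,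
      leftNest s ((l.splitWrtComposition c).map (rightNest s)) = -leftNest s l := by
  have h := sum_leftNest_split hs hl
  rw [← Finset.sum_filter_add_sum_filter_not _ (fun c => c.length < n + 2)] at h
  have h' : (Finset.univ.filter fun c : Composition (n + 2) => ¬c.length < n + 2) =
      {Composition.ones (n + 2)} := by
    ext c
    simp [Composition.eq_ones_iff_le_length]
  rw [h', Finset.sum_singleton, leftNest_split_ones s hl] at h
  exact eq_neg_of_add_eq_zero_left h

lemma splitWrtComposition_ofFn {α : Type*} {n : ℕ} (x : Fin n → α) (c : Composition n) :
    (List.ofFn x).splitWrtComposition c =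
      List.ofFn fun i => List.ofFn fun j => x (c.embedding i j) := by
  refine List.ext_getElem (by simp) fun i h₁ h₂ => ?_
  have hi : i < c.length := by simpa using h₂
  have hle : c.sizeUpTo (i + 1) ≤ n := c.sizeUpTo_le _
  have hs := c.sizeUpTo_succ hi
  rw [List.getElem_splitWrtComposition, List.getElem_ofFn]
  refine List.ext_getElem ?_ fun j _ _ => ?_
  · simp only [List.length_drop, List.length_take, List.length_ofFn, Composition.blocksFun,
      List.get_eq_getElem]
    omega
  · simp only [List.getElem_drop, List.getElem_take, List.getElem_ofFn]
    rfl

section Born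

variable {X Y : Type*} [NormedAddCommGroup X] [NormedSpace ℝ X]
  [NormedAddCommGroup Y] [NormedSpace ℝ Y]
  (K : (j : ℕ) → ContinuousMultilinearMap ℝ (fun _ : Fin j => X) Y) (𝒦₁ : Y →L[ℝ] X)

/-- The product `x ⋆ y = 𝒦₁ (K₂ (x, y))` on `X`. -/
noncomputable def bornMul (x y : X) : X := 𝒦₁ (K 2 ![x, y])

lemma bornMul_neg (x y : X) : bornMul K 𝒦₁ (-x) y = -bornMul K 𝒦₁ x y := by
  have h := (K 2).cons_smul ![y] (-1) x
  simp only [neg_smul, one_smul] at h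
  rw [bornMul, bornMul, ← map_neg]
  exact congrArg 𝒦₁ h

variable {K 𝒦₁}

lemma map_forward_eq_rightNest
    (hleft : ∀ x : X, 𝒦₁ (K 1 (fun _ => x)) = x)
    (hins : ∀ (j n : ℕ), 1 ≤ j → 1 ≤ n → ∀ ξ : Fin (j + n) → X,
      K (j + 1) (Fin.snoc (fun i : Fin j => ξ (Fin.castAdd n i))
          (𝒦₁ (K n (fun i : Fin n => ξ (Fin.natAdd j i)))))
        = K (j + n) ξ) {n : ℕ} (hn : 0 < n) (ξ : Fin n → X) :
    𝒦₁ (K n ξ) = rightNest (bornMul K 𝒦₁) (List.ofFn ξ) := by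
  induction n, hn using Nat.le_induction with
  | base =>
    have e : ξ = fun _ => ξ 0 := by
      ext i
      rw [Subsingleton.elim i 0]
    rw [e, hleft]
    simp [rightNest]
  | succ n hn ih =>
    obtain ⟨m, hm⟩ : ∃ m, m = n + 1 := ⟨_, rfl⟩
    obtain rfl : m = 1 + n := by omega
    revert ξ
    rw [← hm]
    intro ξ
    rw [← hins 1 n le_rfl hn ξ, ih, List.ofFn_add]
    have hne : (List.ofFn fun i : Fin n => ξ (Fin.natAdd 1 i)) ≠ [] := by
      simp only [ne_eq, List.ofFn_eq_nil_iff]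
      omega
    simp only [List.ofFn_succ, List.ofFn_zero, List.singleton_append]
    rw [rightNest_cons _ _ hne, bornMul]
    congr 2
    ext i
    fin_cases i <;> rfl

lemma invBorn_eq_leftNest
    (hleft : ∀ x : X, 𝒦₁ (K 1 (fun _ => x)) = x)
    (hins : ∀ (j n : ℕ), 1 ≤ j → 1 ≤ n → ∀ ξ : Fin (j + n) → X,
      K (j + 1) (Fin.snoc (fun i : Fin j => ξ (Fin.castAdd n i))
          (𝒦₁ (K n (fun i : Fin n => ξ (Fin.natAdd j i)))))
        = K (j + n) ξ) (n : ℕ) (φ : Fin n → Y) :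
    invBorn K 𝒦₁ n φ = leftNest (bornMul K 𝒦₁) (List.ofFn fun i => 𝒦₁ (φ i)) := by
  induction n using Nat.strong_induction_on with
  | _ n ih =>
  match n with
  | 0 => simp [invBorn, leftNest]
  | 1 => simp [invBorn, leftNest]
  | n + 2 =>
    rw [invBorn, neg_eq_iff_eq_neg,
      ← sum_leftNest_split_of_length_lt (bornMul_neg K 𝒦₁) List.length_ofFn]
    refine Eq.trans (Finset.sum_congr rfl fun c _ => ?_) (Finset.sum_attach _ _)
    rw [ih _ (Finset.mem_filter.mp c.2).2, splitWrtComposition_ofFn, List.map_ofFn]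
    congr 2
    ext i
    exact map_forward_eq_rightNest hleft hins (c.1.one_le_blocksFun i) _

lemma redKM_eq_leftNest
    (hleft : ∀ x : X, 𝒦₁ (K 1 (fun _ => x)) = x)
    (hins : ∀ (j n : ℕ), 1 ≤ j → 1 ≤ n → ∀ ξ : Fin (j + n) → X,
      K (j + 1) (Fin.snoc (fun i : Fin j => ξ (Fin.castAdd n i))
          (𝒦₁ (K n (fun i : Fin n => ξ (Fin.natAdd j i)))))
        = K (j + n) ξ) (n : ℕ) (φ : Fin (n + 1) → Y) :
    redKM K 𝒦₁ n φ = leftNest (bornMul K 𝒦₁) (List.ofFn fun i => 𝒦₁ (φ i)) := by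
  induction n with
  | zero => simp [redKM, leftNest]
  | succ n ih =>
    match n with
    | 0 => exact invBorn_eq_leftNest hleft hins 2 φ
    | n + 1 =>
      have hleft' (x : X) : 𝒦₁ (K 1 ![x]) = x := by
        simpa only [Matrix.vec_single_eq_const] using hleft x
      rw [redKM, ih, List.ofFn_succ]
      simp only [Fin.cons_zero, Fin.cons_succ, hleft']
      rw [← leftNest_neg_cons (bornMul_neg K 𝒦₁),
        List.ofFn_succ (f := fun i => 𝒦₁ (φ i)), List.ofFn_succ (n := n + 1)]
      rfl

lemma fastIterM_succ_sub (φ : Y) (n : ℕ) :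
    fastIterM K 𝒦₁ φ (n + 1) - fastIterM K 𝒦₁ φ n =
      leftNest (bornMul K 𝒦₁) (List.replicate (n + 1) (𝒦₁ φ)) := by
  induction n with
  | zero => simp [fastIterM, leftNest]
  | succ n ih =>
    rw [List.replicate_succ', leftNest_concat _ (by simp), ← ih, fastIterM, sub_sub_cancel_left]
    rfl

end Born

/-- **Section 8.1: with an exact left inverse and the exact insertion identity, the
inverse Born series and the reduced inverse Born series coincide term by term, and the
fast iterates are exactly the partial sums of the inverse Born series.**
Assume (i) `𝒦₁∘K₁ = I` on `X` and (ii) the exact insertion identity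
`K_{j+1}(ξ₁,…,ξ_j, 𝒦₁ K_n(ξ_{j+1},…,ξ_{j+n})) = K_{j+n}(ξ₁,…,ξ_{j+n})`.
Then `𝒦_n = K̃_n` for every `n ≥ 1`, and for the fast iterates
`η̃⁽ⁿ⁾ = Σ_{j=1}^n 𝒦_j(φ,…,φ)` for every `n ≥ 1` and `φ ∈ Y`. -/
theorem stmt_12 {X Y : Type*} [NormedAddCommGroup X] [NormedSpace ℝ X] [CompleteSpace X]
    [NormedAddCommGroup Y] [NormedSpace ℝ Y] [CompleteSpace Y]
    (K : (j : ℕ) → ContinuousMultilinearMap ℝ (fun _ : Fin j => X) Y)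
    (𝒦₁ : Y →L[ℝ] X)
    (hleft : ∀ x : X, 𝒦₁ (K 1 (fun _ => x)) = x)
    (hins : ∀ (j n : ℕ), 1 ≤ j → 1 ≤ n → ∀ ξ : Fin (j + n) → X,
      K (j + 1) (Fin.snoc (fun i : Fin j => ξ (Fin.castAdd n i))
          (𝒦₁ (K n (fun i : Fin n => ξ (Fin.natAdd j i)))))
        = K (j + n) ξ) :
    (∀ (n : ℕ) (φ : Fin (n + 1) → Y), invBorn K 𝒦₁ (n + 1) φ = redKM K 𝒦₁ n φ) ∧
    (∀ (φ : Y) (n : ℕ), 1 ≤ n →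
      fastIterM K 𝒦₁ φ n =
        ∑ j ∈ Finset.range n, invBorn K 𝒦₁ (j + 1) (fun _ => φ)) := by
  refine ⟨fun n φ => ?_, fun φ n _ => ?_⟩
  · rw [invBorn_eq_leftNest hleft hins, redKM_eq_leftNest hleft hins]
  · have h (j : ℕ) : invBorn K 𝒦₁ (j + 1) (fun _ => φ) =
        fastIterM K 𝒦₁ φ (j + 1) - fastIterM K 𝒦₁ φ j := by
      rw [invBorn_eq_leftNest hleft hins, fastIterM_succ_sub, List.ofFn_const]
    simp only [h, Finset.sum_range_sub, fastIterM, sub_zero]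
end

section
/- Let X and Y be real Banach spaces. For each j ≥ 1 let K_j : X^j → Y be a continuous multilinear map, let 𝒦₁ : Y → X be a bounded linear operator, and let φ ∈ Y. Set η₁ := 𝒦₁φ and h := ‖η₁‖, and assume Σ_{j=1}^∞ ‖K_j‖ h^j < ∞, so that K η₁ := Σ_{j=1}^∞ K_j(η₁,…,η₁) converges in Y. Set η₂ := −𝒦₁(K₂(η₁,η₁)) and define the second iterate of the Newton-type scheme η⁽²⁾ := η₁ − 𝒦₁(K η₁ − φ). Then one has the exact identity η⁽²⁾ = η₁ + η₂ + (η₁ − 𝒦₁(K₁ η₁)) − 𝒦₁( Σ_{m=3}^∞ K_m(η₁,…,η₁) ), and consequently ‖η⁽²⁾ − (η₁ + η₂)‖ ≤ ‖𝒦₁∘K₁ − I‖·h + ‖𝒦₁‖·Σ_{m=3}^∞ ‖K_m‖ h^m. -/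
/-- **Section 5: the second Newton iterate agrees with the second partial sum of the
inverse Born series up to order `ε` plus a tail of order `h³`.**  Let `K_j` be the
multilinear forward operators of the Born series, `𝒦₁` the regularized pseudoinverse
of `K₁`, and `φ` the data.  Set `η₁ = 𝒦₁φ`, `h = ‖η₁‖`, and assume
`Σ_{j≥1} ‖K_j‖ hʲ < ∞`, so that `K η₁ = Σ_{j≥1} K_j(η₁,…,η₁)` converges.  With
`η₂ = -𝒦₁(K₂(η₁,η₁))` and `η⁽²⁾ = η₁ - 𝒦₁(K η₁ - φ)`, one has the exact identity
`η⁽²⁾ = η₁ + η₂ + (η₁ - 𝒦₁(K₁η₁)) - 𝒦₁(Σ_{m≥3} K_m(η₁,…,η₁))`, and consequently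
`‖η⁽²⁾ - (η₁ + η₂)‖ ≤ ‖𝒦₁∘K₁ - I‖·h + ‖𝒦₁‖·Σ_{m≥3} ‖K_m‖ hᵐ`. -/
theorem stmt_13 {X Y : Type*} [NormedAddCommGroup X] [NormedSpace ℝ X] [CompleteSpace X]
    [NormedAddCommGroup Y] [NormedSpace ℝ Y] [CompleteSpace Y]
    (K : (j : ℕ) → ContinuousMultilinearMap ℝ (fun _ : Fin j => X) Y)
    (𝒦₁ : Y →L[ℝ] X) (φ : Y)
    (η₁ : X) (hη₁ : η₁ = 𝒦₁ φ)
    (hsum : Summable (fun j : ℕ => ‖K (j + 1)‖ * ‖η₁‖ ^ (j + 1)))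
    (Kη₁ : Y) (hKη₁ : Kη₁ = ∑' j : ℕ, K (j + 1) (fun _ => η₁))
    (η₂ : X) (hη₂ : η₂ = -𝒦₁ (K 2 (fun _ => η₁)))
    (ηsecond : X) (hηsecond : ηsecond = η₁ - 𝒦₁ (Kη₁ - φ)) :
    ηsecond =
      η₁ + η₂ + (η₁ - 𝒦₁ (K 1 (fun _ => η₁))) -
        𝒦₁ (∑' m : ℕ, K (m + 3) (fun _ => η₁)) ∧
    ‖ηsecond - (η₁ + η₂)‖ ≤
      ‖𝒦₁.comp (continuousMultilinearCurryFin1 ℝ X Y (K 1)) -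
          ContinuousLinearMap.id ℝ X‖ * ‖η₁‖ +
        ‖𝒦₁‖ * ∑' m : ℕ, ‖K (m + 3)‖ * ‖η₁‖ ^ (m + 3) := by
  have hbound (j : ℕ) : ‖K j (fun _ => η₁)‖ ≤ ‖K j‖ * ‖η₁‖ ^ j := by
    simpa using (K j).le_opNorm (fun _ => η₁)
  have hK : Summable (fun j : ℕ => K (j + 1) (fun _ => η₁)) :=
    .of_norm_bounded hsum fun j => hbound (j + 1)
  have htail : Summable (fun m : ℕ => ‖K (m + 3)‖ * ‖η₁‖ ^ (m + 3)) :=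
    (summable_nat_add_iff 2).2 hsum
  have hsplit : Kη₁ = K 1 (fun _ => η₁) + K 2 (fun _ => η₁) +
      ∑' m : ℕ, K (m + 3) (fun _ => η₁) := by
    rw [hKη₁, ← hK.sum_add_tsum_nat_add 2]
    simp [Finset.sum_range_succ]
  have hid : ηsecond = η₁ + η₂ + (η₁ - 𝒦₁ (K 1 (fun _ => η₁))) -
      𝒦₁ (∑' m : ℕ, K (m + 3) (fun _ => η₁)) := by
    rw [hηsecond, hη₂, hsplit, map_sub, map_add, map_add, ← hη₁]
    abel
  refine ⟨hid, ?_⟩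
  set A := 𝒦₁.comp (continuousMultilinearCurryFin1 ℝ X Y (K 1) : X →L[ℝ] Y) -
    ContinuousLinearMap.id ℝ X with hA
  have hAη : A η₁ = 𝒦₁ (K 1 (fun _ => η₁)) - η₁ := by
    have : (![η₁] : Fin 1 → X) = fun _ => η₁ := by
      ext i
      fin_cases i
      rfl
    simp [hA, this]
  have hdiff : ηsecond - (η₁ + η₂) =
      -(A η₁ + 𝒦₁ (∑' m : ℕ, K (m + 3) (fun _ => η₁))) := by
    rw [hid, hAη]
    abel
  rw [hdiff, norm_neg]
  refine (norm_add_le _ _).trans (add_le_add (A.le_opNorm η₁) ?_)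
  refine (𝒦₁.le_opNorm _).trans (mul_le_mul_of_nonneg_left ?_ (norm_nonneg _))
  exact tsum_of_norm_bounded htail.hasSum fun m => hbound (m + 3)
end
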